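/- arXiv:1902.03267 — 3 statements merged into one kernel-verified Lean document; each statement's English description precedes it below -/
import Mathlib

section
/- Let X be a paracompact Hausdorff C-space, Y a Hausdorff topological space, and φ_n : X ⇝ Y (n < ω) an aspherical sequence of lower locally constant set-valued mappings. Then there exists a continuous map f : X → Y such that f(x) ∈ ⋃_{n<ω} φ_n(x) for every x ∈ X. -/
/-- `EmbedIn k S B` means `S ↪_k B`: every continuous map from the unit `k`-sphere of
`ℝ^{k+1}` into `S` extends to a continuous map from the closed unit `(k+1)`-ball into `B`. -/
def EmbedIn {Y : Type*} [TopologicalSpace Y] (k : ℕ) (S B : Set Y) : Prop :=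
  ∀ f : (Metric.sphere (0 : EuclideanSpace ℝ (Fin (k + 1))) 1) → Y,
    Continuous f → Set.range f ⊆ S →
      ∃ g : (Metric.closedBall (0 : EuclideanSpace ℝ (Fin (k + 1))) 1) → Y,
        Continuous g ∧ Set.range g ⊆ B ∧
          ∀ z, g (Set.inclusion Metric.sphere_subset_closedBall z) = f z

/-- A set-valued mapping `Φ : X ⇝ Y` is lower locally constant if
`{x | K ⊆ Φ x}` is open for every compact `K ⊆ Y`. -/
def LowerLocallyConstant {X Y : Type*} [TopologicalSpace X] [TopologicalSpace Y]
    (Φ : X → Set Y) : Prop :=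
  ∀ K : Set Y, IsCompact K → IsOpen {x | K ⊆ Φ x}

/-- `X` is a C-space. -/
def IsCSpace (X : Type*) [TopologicalSpace X] : Prop :=
  ∀ U : ℕ → Set (Set X),
    (∀ n, (∀ u ∈ U n, IsOpen u) ∧ ⋃₀ U n = Set.univ) →
      ∃ V : ℕ → Set (Set X),
        (∀ n, ∀ v ∈ V n, IsOpen v) ∧
        (∀ n, (V n).Pairwise Disjoint) ∧
        (∀ n, ∀ v ∈ V n, ∃ u ∈ U n, v ⊆ u) ∧
        (⋃ n, ⋃₀ V n) = Set.univ

open Set Topology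

/-- The geometric simplex in `V → ℝ` spanned by the finite vertex set `σ`. -/
def geomSimplex {V : Type*} (σ : Finset V) : Set (V → ℝ) :=
  {t | (∀ v, 0 ≤ t v) ∧ (∀ v, v ∉ σ → t v = 0) ∧ ∑ v ∈ σ, t v = 1}

/-- The boundary of the geometric simplex spanned by `σ`. -/
def geomBoundary {V : Type*} (σ : Finset V) : Set (V → ℝ) :=
  {t | t ∈ geomSimplex σ ∧ ∃ v ∈ σ, t v = 0}

theorem isClosed_geomSimplex {V : Type*} (σ : Finset V) : IsClosed (geomSimplex σ) := by
  simp only [geomSimplex, ofPred_and, ofPred_forall]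
  refine .inter (isClosed_iInter fun v => isClosed_le continuous_const (continuous_apply v))
    (.inter (isClosed_iInter fun v => isClosed_iInter fun _ =>
      isClosed_eq (continuous_apply v) continuous_const)
      (isClosed_eq (by fun_prop) continuous_const))

theorem isCompact_geomSimplex {V : Type*} (σ : Finset V) : IsCompact (geomSimplex σ) := by
  refine (isCompact_univ_pi (fun _ : V => isCompact_Icc (a := (0 : ℝ)) (b := 1))).of_isClosed_subset
    (isClosed_geomSimplex σ) ?_
  rintro t ⟨h0, hσ, h1⟩ v -
  refine ⟨h0 v, ?_⟩
  by_cases hv : v ∈ σ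
  · exact h1 ▸ Finset.single_le_sum (fun w _ => h0 w) hv
  · simp [hσ v hv]

theorem mem_geomSimplex_erase {V : Type*} [DecidableEq V] {σ : Finset V} {v : V} (hv : v ∈ σ)
    {t : V → ℝ} : t ∈ geomSimplex (σ.erase v) ↔ t ∈ geomSimplex σ ∧ t v = 0 := by
  have hs := Finset.add_sum_erase σ t hv
  constructor
  · rintro ⟨h0, hσ, h1⟩
    have htv : t v = 0 := hσ v (by simp)
    refine ⟨⟨h0, fun w hw => hσ w fun h => hw (Finset.mem_of_mem_erase h), ?_⟩, htv⟩
    linarith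
  · rintro ⟨⟨h0, hσ, h1⟩, htv⟩
    refine ⟨h0, fun w hw => ?_, by linarith⟩
    by_cases hwv : w = v
    · rw [hwv, htv]
    · exact hσ w fun h => hw (Finset.mem_erase.2 ⟨hwv, h⟩)

theorem geomBoundary_eq_iUnion {V : Type*} [DecidableEq V] (σ : Finset V) :
    geomBoundary σ = ⋃ v : σ, geomSimplex (σ.erase v) := by
  ext t
  simp only [geomBoundary, mem_ofPred_eq, mem_iUnion, Subtype.exists]
  constructor
  · rintro ⟨h, v, hv, h0⟩
    exact ⟨v, hv, (mem_geomSimplex_erase hv).2 ⟨h, h0⟩⟩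
  · rintro ⟨v, hv, h⟩
    exact ⟨((mem_geomSimplex_erase hv).1 h).1, v, hv, ((mem_geomSimplex_erase hv).1 h).2⟩

/-- The corner simplex of `ℝⁿ`, the convex hull of the origin and the standard basis. -/
def cornerSimplex (n : ℕ) : Set (EuclideanSpace ℝ (Fin n)) :=
  {s | (∀ i, 0 ≤ s i) ∧ ∑ i, s i ≤ 1}

theorem isClosed_cornerSimplex (n : ℕ) : IsClosed (cornerSimplex n) := by
  simp only [cornerSimplex, ofPred_and, ofPred_forall]
  exact .inter (isClosed_iInter fun i => isClosed_le continuous_const (by fun_prop))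
    (isClosed_le (by fun_prop) continuous_const)

theorem convex_cornerSimplex (n : ℕ) : Convex ℝ (cornerSimplex n) := by
  rintro x ⟨hx0, hx1⟩ y ⟨hy0, hy1⟩ a b ha hb hab
  constructor
  · intro i
    have := hx0 i
    have := hy0 i
    simp only [PiLp.add_apply, PiLp.smul_apply, smul_eq_mul]
    positivity
  · simp only [PiLp.add_apply, PiLp.smul_apply, smul_eq_mul, Finset.sum_add_distrib,
      ← Finset.mul_sum]
    nlinarith

theorem isBounded_cornerSimplex (n : ℕ) : Bornology.IsBounded (cornerSimplex n) := by
  refine (Metric.isBounded_closedBall (x := 0) (r := 1)).subset ?_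
  rintro s ⟨h0, h1⟩
  rw [mem_closedBall_zero_iff, ← sq_le_one_iff₀ (norm_nonneg s), EuclideanSpace.norm_sq_eq]
  refine le_trans (Finset.sum_le_sum fun i _ => ?_) h1
  have h0i := h0 i
  have : s i ≤ 1 := (Finset.single_le_sum (fun j _ => h0 j) (Finset.mem_univ i)).trans h1
  rw [Real.norm_eq_abs, sq_abs]
  nlinarith

theorem mem_interior_cornerSimplex {n : ℕ} (hn : 0 < n) {s : EuclideanSpace ℝ (Fin n)} :
    s ∈ interior (cornerSimplex n) ↔ (∀ i, 0 < s i) ∧ ∑ i, s i < 1 := by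
  constructor
  · intro hs
    set u : EuclideanSpace ℝ (Fin n) := WithLp.toLp 2 fun _ => 1
    have hc : Filter.Tendsto (fun r : ℝ => s + r • u) (𝓝 0) (𝓝 s) := by
      have : Continuous fun r : ℝ => s + r • u := by fun_prop
      simpa using this.tendsto 0
    obtain ⟨ε, hε, h⟩ := Metric.eventually_nhds_iff.1 (hc (mem_interior_iff_mem_nhds.1 hs))
    have hp := h (y := ε / 2) (by rw [Real.dist_0_eq_abs, abs_of_pos] <;> linarith)
    have hm := h (y := -(ε / 2)) (by rw [Real.dist_0_eq_abs, abs_neg, abs_of_pos] <;> linarith)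
    constructor
    · intro i
      have := hm.1 i
      simp [u] at this
      linarith
    · have h1 := hp.2
      have : (0 : ℝ) < n := by exact_mod_cast hn
      simp [u, Finset.sum_add_distrib] at h1
      nlinarith
  · rintro ⟨h0, h1⟩
    refine mem_interior.2 ⟨{s | (∀ i, 0 < s i) ∧ ∑ i, s i < 1},
      fun s hs => ⟨fun i => (hs.1 i).le, hs.2.le⟩, ?_, h0, h1⟩
    simp only [ofPred_and, ofPred_forall]
    exact .inter (isOpen_iInter_of_finite fun i => isOpen_lt continuous_const (by fun_prop))
      (isOpen_lt (by fun_prop) continuous_const)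

theorem mem_frontier_cornerSimplex {n : ℕ} (hn : 0 < n) {s : EuclideanSpace ℝ (Fin n)} :
    s ∈ frontier (cornerSimplex n) ↔
      s ∈ cornerSimplex n ∧ ((∃ i, s i = 0) ∨ ∑ i, s i = 1) := by
  rw [(isClosed_cornerSimplex n).frontier_eq, mem_sdiff, mem_interior_cornerSimplex hn]
  refine and_congr_right fun hs => ?_
  rw [not_and_or, not_forall, not_lt]
  refine or_congr (exists_congr fun i => ?_) ⟨fun h => le_antisymm hs.2 h, fun h => h.ge⟩
  rw [not_lt]
  exact ⟨fun h => le_antisymm h (hs.1 i), fun h => h.le⟩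

theorem interior_cornerSimplex_nonempty {n : ℕ} (hn : 0 < n) :
    (interior (cornerSimplex n)).Nonempty := by
  refine ⟨WithLp.toLp 2 fun _ => 1 / ((n : ℝ) + 1), (mem_interior_cornerSimplex hn).2 ⟨?_, ?_⟩⟩
  · intro i
    simp only
    positivity
  · simp only [Finset.sum_const, Finset.card_univ, Fintype.card_fin, nsmul_eq_mul]
    rw [mul_one_div, div_lt_one (by positivity)]
    linarith

/-- A parametrisation of the corner simplex by a geometric simplex with one more vertex. -/
theorem exists_geomSimplex_cornerSimplex_maps {V : Type*} {k : ℕ} {σ : Finset V}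
    (hσ : σ.card = k + 2) :
    ∃ (a : (V → ℝ) → EuclideanSpace ℝ (Fin (k + 1))) (c : EuclideanSpace ℝ (Fin (k + 1)) → V → ℝ),
      Continuous a ∧ Continuous c ∧ MapsTo a (geomSimplex σ) (cornerSimplex (k + 1)) ∧
      MapsTo a (geomBoundary σ) (frontier (cornerSimplex (k + 1))) ∧
      MapsTo c (frontier (cornerSimplex (k + 1))) (geomBoundary σ) ∧
      ∀ t ∈ geomSimplex σ, c (a t) = t := by
  classical
  let e : σ ≃ Fin (k + 2) := σ.equivFinOfCardEq hσ
  have hsum (t : V → ℝ) : ∑ v ∈ σ, t v =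
      ∑ i : Fin (k + 1), t (e.symm i.castSucc) + t (e.symm (Fin.last _)) := by
    rw [← Finset.sum_coe_sort, ← e.symm.sum_comp, Fin.sum_univ_castSucc]
  let a : (V → ℝ) → EuclideanSpace ℝ (Fin (k + 1)) :=
    fun t => WithLp.toLp 2 fun i => t (e.symm i.castSucc)
  let c : EuclideanSpace ℝ (Fin (k + 1)) → V → ℝ := fun s v =>
    if h : v ∈ σ then Fin.snoc (α := fun _ => ℝ) (fun i => s i) (1 - ∑ i, s i) (e ⟨v, h⟩) else 0
  have hc1 (s i) : c s (e.symm (Fin.castSucc i)) = s i := by simp [c]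
  have hc2 (s) : c s (e.symm (Fin.last _)) = 1 - ∑ i, s i := by simp [c]
  have hv (v : V) (hv : v ∈ σ) : (∃ i, v = e.symm (Fin.castSucc i)) ∨ v = e.symm (Fin.last _) := by
    obtain ⟨j, hj⟩ : ∃ j, e.symm j = ⟨v, hv⟩ := e.symm.surjective _
    obtain rfl : v = e.symm j := by rw [hj]
    refine Fin.lastCases (Or.inr rfl) (fun i => Or.inl ⟨i, rfl⟩) j
  have ha : MapsTo a (geomSimplex σ) (cornerSimplex (k + 1)) := by
    rintro t ⟨h0, -, h1⟩
    refine ⟨fun i => h0 _, ?_⟩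
    rw [hsum] at h1
    have := h0 (e.symm (Fin.last _))
    simp only [a]
    linarith
  refine ⟨a, c, by fun_prop, ?_, ha, ?_, ?_, ?_⟩
  · refine continuous_pi fun v => ?_
    by_cases h : v ∈ σ
    · rcases hv v h with ⟨i, rfl⟩ | rfl
      · simp only [hc1]
        fun_prop
      · simp only [hc2]
        fun_prop
    · simp only [c, dif_neg h]
      exact continuous_const
  · rintro t ⟨ht, v, hvσ, htv⟩
    refine (mem_frontier_cornerSimplex k.succ_pos).2 ⟨ha ht, ?_⟩
    rcases hv v hvσ with ⟨i, rfl⟩ | rfl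
    · exact Or.inl ⟨i, htv⟩
    · have h1 := ht.2.2
      rw [hsum, htv, add_zero] at h1
      exact Or.inr h1
  · intro s hs
    obtain ⟨⟨h0, h1⟩, hs⟩ := (mem_frontier_cornerSimplex k.succ_pos).1 hs
    refine ⟨⟨fun v => ?_, fun v h => by simp [c, h], ?_⟩, ?_⟩
    · by_cases h : v ∈ σ
      · rcases hv v h with ⟨i, rfl⟩ | rfl
        · rw [hc1]
          exact h0 i
        · rw [hc2]
          linarith
      · simp [c, h]
    · rw [hsum, hc2]
      simp only [hc1]
      ring
    · rcases hs with ⟨i, hi⟩ | hs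
      · exact ⟨_, (e.symm i.castSucc).2, by rw [hc1, hi]⟩
      · exact ⟨_, (e.symm (Fin.last _)).2, by rw [hc2, hs, sub_self]⟩
  · intro t ht
    ext v
    by_cases h : v ∈ σ
    · rcases hv v h with ⟨i, rfl⟩ | rfl
      · rw [hc1]
      · have h1 := ht.2.2
        rw [hsum] at h1
        rw [hc2]
        simp only [a]
        linarith
    · simp [c, h, ht.2.1 v h]

theorem EmbedIn.exists_extension_geomSimplex {V Y : Type*} [TopologicalSpace Y] {k : ℕ}
    {S B : Set Y} (h : EmbedIn k S B) {σ : Finset V} (hσ : σ.card = k + 2) {b : (V → ℝ) → Y}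
    (hb : ContinuousOn b (geomBoundary σ)) (hbS : MapsTo b (geomBoundary σ) S) :
    ∃ g : (V → ℝ) → Y, ContinuousOn g (geomSimplex σ) ∧ MapsTo g (geomSimplex σ) B ∧
      EqOn g b (geomBoundary σ) := by
  classical
  obtain ⟨a, c, ha, hc, haΔ, ha', hc', hca⟩ := exists_geomSimplex_cornerSimplex_maps hσ
  obtain ⟨Θ, -, hΘ, hΘ'⟩ := exists_homeomorph_image_interior_closure_frontier_eq_unitBall
    (convex_cornerSimplex (k + 1)) (interior_cornerSimplex_nonempty k.succ_pos)
    (isBounded_cornerSimplex (k + 1))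
  rw [(isClosed_cornerSimplex _).closure_eq] at hΘ
  have hsymm (z : Metric.sphere (0 : EuclideanSpace ℝ (Fin (k + 1))) 1) :
      c (Θ.symm z) ∈ geomBoundary σ := by
    refine hc' ?_
    obtain ⟨s, hs, hsz⟩ := hΘ'.ge z.2
    rwa [← hsz, Θ.symm_apply_apply]
  obtain ⟨G, hGc, hGB, hG⟩ := h (fun z => b (c (Θ.symm z)))
    (hb.comp_continuous (by fun_prop) hsymm) (range_subset_iff.2 fun z => hbS (hsymm z))
  have hball (t) (ht : t ∈ geomSimplex σ) : Θ (a t) ∈ Metric.closedBall 0 1 :=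
    hΘ.le (mem_image_of_mem _ (haΔ ht))
  let g : (V → ℝ) → Y := fun t => if h : Θ (a t) ∈ Metric.closedBall 0 1 then G ⟨_, h⟩ else b t
  have hg (t) (ht : t ∈ geomSimplex σ) : g t = G ⟨_, hball t ht⟩ := dif_pos _
  refine ⟨g, ?_, ?_, ?_⟩
  · rw [continuousOn_iff_continuous_domRestrict]
    have : (geomSimplex σ).domRestrict g =
        fun t : geomSimplex σ => G ⟨_, hball t t.2⟩ := funext fun t => hg t t.2
    rw [this]
    fun_prop
  · intro t ht
    rw [hg t ht]
    exact hGB (mem_range_self _)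
  · intro t ht
    rw [hg t ht.1]
    have hs : Θ (a t) ∈ Metric.sphere 0 1 := hΘ'.le (mem_image_of_mem _ (ha' ht))
    have := hG ⟨_, hs⟩
    rw [Θ.symm_apply_apply, hca t ht.1] at this
    exact this

/-- A map on the infinite simplex, built by induction over skeleta: whenever its restriction to the
boundary of a simplex `σ` is continuous with values in `Ψ σ k`, it fills `σ` within
`Ψ σ (k + 1)`. -/
theorem exists_skeletal_extension {V Y : Type*} [TopologicalSpace Y] (Ψ : Finset V → ℕ → Set Y)
    (h0 : ∀ σ, (Ψ σ 0).Nonempty) (hk : ∀ σ k, EmbedIn k (Ψ σ k) (Ψ σ (k + 1))) :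
    ∃ H : (V → ℝ) → Y, ∀ σ k, σ.card = k + 1 → ContinuousOn H (geomBoundary σ) →
      MapsTo H (geomBoundary σ) (Ψ σ (k - 1)) →
      ContinuousOn H (geomSimplex σ) ∧ MapsTo H (geomSimplex σ) (Ψ σ k) := by
  classical
  have hext (σ : Finset V) (b : (V → ℝ) → Y) : ∃ g : (V → ℝ) → Y, EqOn g b (geomBoundary σ) ∧
      ∀ k, σ.card = k + 1 → ContinuousOn b (geomBoundary σ) →
        MapsTo b (geomBoundary σ) (Ψ σ (k - 1)) →
        ContinuousOn g (geomSimplex σ) ∧ MapsTo g (geomSimplex σ) (Ψ σ k) := by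
    by_cases hgood : ∃ k, σ.card = k + 1 ∧ ContinuousOn b (geomBoundary σ) ∧
        MapsTo b (geomBoundary σ) (Ψ σ (k - 1))
    · obtain ⟨k, hσ, hb, hbm⟩ := hgood
      suffices ∃ g : (V → ℝ) → Y, EqOn g b (geomBoundary σ) ∧
          ContinuousOn g (geomSimplex σ) ∧ MapsTo g (geomSimplex σ) (Ψ σ k) by
        obtain ⟨g, hg, hg'⟩ := this
        refine ⟨g, hg, fun k' hk' _ _ => ?_⟩
        obtain rfl : k = k' := by omega
        exact hg'
      rcases k with - | k
      · obtain ⟨y, hy⟩ := h0 σ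
        refine ⟨fun _ => y, ?_, continuousOn_const, fun _ _ => hy⟩
        obtain ⟨v, rfl⟩ := Finset.card_eq_one.1 hσ
        rintro t ⟨⟨-, -, h1⟩, w, hw, hw0⟩
        simp_all
      · obtain ⟨g, hgc, hgm, hg⟩ := (hk σ k).exists_extension_geomSimplex hσ hb hbm
        exact ⟨g, hg, hgc, hgm⟩
    · exact ⟨b, fun _ _ => rfl, fun k h₁ h₂ h₃ => (hgood ⟨k, h₁, h₂, h₃⟩).elim⟩
  choose E hE hE' using hext
  obtain ⟨y₀, -⟩ := h0 ∅
  let supp : (V → ℝ) → Finset V := fun t =>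
    if h : (Function.support t).Finite then h.toFinset else ∅
  have hsupp {σ : Finset V} {t : V → ℝ} (ht : t ∈ geomSimplex σ) (v : V) :
      v ∈ supp t ↔ t v ≠ 0 := by
    have : (Function.support t).Finite :=
      σ.finite_toSet.subset fun v hv => by_contra fun h => hv (ht.2.1 v h)
    simp [supp, this]
  let bd (σ : Finset V) (IH : ∀ τ ⊂ σ, (V → ℝ) → Y) : (V → ℝ) → Y := fun t =>
    if h : supp t ⊂ σ then IH (supp t) h t else y₀
  let G : Finset V → (V → ℝ) → Y := Finset.strongInduction fun σ IH => E σ (bd σ IH)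
  have hG (σ) : G σ = E σ (bd σ fun τ _ => G τ) := Finset.strongInduction_eq _ _
  have hsub {σ : Finset V} {t : V → ℝ} (ht : t ∈ geomBoundary σ) : supp t ⊂ σ := by
    obtain ⟨ht, v, hv, htv⟩ := ht
    refine (Finset.ssubset_iff_of_subset fun w hw => ?_).2 ⟨v, hv, by simp [hsupp ht, htv]⟩
    exact by_contra fun h => (hsupp ht w).1 hw (ht.2.1 w h)
  have hbd (σ) : EqOn (fun t => G (supp t) t) (bd σ fun τ _ => G τ) (geomBoundary σ) :=
    fun t ht => by simp only [bd, dif_pos (hsub ht)]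
  have hΔ (σ) : EqOn (fun t => G (supp t) t) (E σ (bd σ fun τ _ => G τ)) (geomSimplex σ) := by
    intro t ht
    by_cases h : ∃ v ∈ σ, t v = 0
    · rw [hbd σ ⟨ht, h⟩, hE _ _ ⟨ht, h⟩]
    · have : supp t = σ := by
        ext v
        rw [hsupp ht]
        exact ⟨fun hv => by_contra fun h => hv (ht.2.1 v h), fun hv h0 => h ⟨v, hv, h0⟩⟩
      simp only [this, ← hG]
  refine ⟨fun t => G (supp t) t, fun σ k hσ hc hm => ?_⟩
  obtain ⟨h₁, h₂⟩ := hE' σ (bd σ fun τ _ => G τ) k hσ (hc.congr (hbd σ).symm)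
    (hm.congr (hbd σ))
  exact ⟨h₁.congr (hΔ σ), h₂.congr (hΔ σ).symm⟩

/-- Construction of a sequence whose `n`-th term is subject to a condition on the previous terms. -/
theorem exists_seq_of_forall_exists_of_lt {α : Type*} [Nonempty α] (Q : ℕ → (ℕ → α) → α → Prop)
    (hQ : ∀ n F, ∃ a, Q n F a)
    (hcongr : ∀ n F F' a, (∀ m < n, F m = F' m) → Q n F a → Q n F' a) :
    ∃ F : ℕ → α, ∀ n, Q n F (F n) := by
  choose c hc using hQ
  let prev (n : ℕ) (IH : ∀ m < n, α) : ℕ → α := fun m =>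
    if h : m < n then IH m h else Classical.arbitrary α
  let F : ℕ → α := fun n => Nat.strongRecOn n fun n IH => c n (prev n IH)
  have hF (n) : F n = c n (prev n fun m _ => F m) := Nat.strongRecOn_eq _ n
  refine ⟨F, fun n => hcongr n (prev n fun m _ => F m) F (F n) (fun m hm => dif_pos hm) ?_⟩
  rw [hF n]
  exact hc _ _

/-- In a paracompact Hausdorff space, neighbourhoods assigned to the points contain the closures of
a locally finite open cover indexed by the points. -/
theorem exists_locallyFinite_cover_closure_subset {X : Type*} [TopologicalSpace X] [T2Space X]
    [ParacompactSpace X] (O : X → Set X) (hO : ∀ x, O x ∈ 𝓝 x) :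
    ∃ W : X → Set X, ((∀ x, IsOpen (W x)) ∧ LocallyFinite W ∧ ⋃ x, W x = univ) ∧
      ∀ x, closure (W x) ⊆ O x := by
  obtain ⟨U, hUo, hUc, hUl, hUO⟩ := precise_refinement (fun x => interior (O x))
    (fun _ => isOpen_interior)
    (iUnion_eq_univ_iff.2 fun x => ⟨x, mem_interior_iff_mem_nhds.2 (hO x)⟩)
  obtain ⟨W, hWc, hWo, hWU⟩ := exists_iUnion_eq_closure_subset hUo hUl.point_finite hUc
  exact ⟨W, ⟨hWo, hUl.subset fun x => subset_closure.trans (hWU x), hWc⟩,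
    fun x => (hWU x).trans ((hUO x).trans interior_subset)⟩

/-- The `n`-th cover `W` is *compatible* with the previous covers `F m` and the skeletal map `H` if,
for each `x`, the closure of `W x` avoids the closed sets `closure (F m y)` not containing `x`, and
each simplex with top vertex `(n, x)` that is filled within `φ k x` is filled within `φ k z` for all
`z ∈ closure (W x)`. -/
def CompatibleCover {X Y : Type*} [TopologicalSpace X] [DecidableEq X] (φ : ℕ → X → Set Y)
    [TopologicalSpace Y] (H : (ℕ × X → ℝ) → Y) (n : ℕ) (F : ℕ → X → Set X) (W : X → Set X) :
    Prop :=
  ∀ x, ∀ z ∈ closure (W x), (∀ m < n, ∀ y, z ∈ closure (F m y) → x ∈ closure (F m y)) ∧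
    ∀ σ : Finset (ℕ × X), (∀ v ∈ σ, v.1 < n ∧ x ∈ closure (F v.1 v.2)) →
      ContinuousOn H (geomSimplex (insert (n, x) σ)) →
      MapsTo H (geomSimplex (insert (n, x) σ)) (φ σ.card x) →
      MapsTo H (geomSimplex (insert (n, x) σ)) (φ σ.card z)

theorem exists_compatibleCover {X Y : Type*} [TopologicalSpace X] [T2Space X] [ParacompactSpace X]
    [DecidableEq X] [TopologicalSpace Y] {φ : ℕ → X → Set Y} (hφ : ∀ n, LowerLocallyConstant (φ n))
    (H : (ℕ × X → ℝ) → Y) (n : ℕ) (F : ℕ → X → Set X) (hF : ∀ m < n, LocallyFinite (F m)) :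
    ∃ W : X → Set X, ((∀ x, IsOpen (W x)) ∧ LocallyFinite W ∧ ⋃ x, W x = univ) ∧
      CompatibleCover φ H n F W := by
  suffices h : ∀ x, ∀ᶠ z in 𝓝 x, (∀ m < n, ∀ y, z ∈ closure (F m y) → x ∈ closure (F m y)) ∧
      ∀ σ : Finset (ℕ × X), (∀ v ∈ σ, v.1 < n ∧ x ∈ closure (F v.1 v.2)) →
        ContinuousOn H (geomSimplex (insert (n, x) σ)) →
        MapsTo H (geomSimplex (insert (n, x) σ)) (φ σ.card x) →
        MapsTo H (geomSimplex (insert (n, x) σ)) (φ σ.card z) by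
    obtain ⟨W, hW, hWO⟩ := exists_locallyFinite_cover_closure_subset _ h
    exact ⟨W, hW, fun x z hz => hWO x hz⟩
  intro x
  refine Filter.Eventually.and ?_ ?_
  · refine (Filter.eventually_all_finite (finite_lt_nat n)).2 fun m hm => ?_
    filter_upwards [(hF m hm).closure.iInter_compl_mem_nhds (fun _ => isClosed_closure) x]
      with z hz y hzy
    by_contra hxy
    exact mem_iInter₂.1 hz y hxy hzy
  · have hfin : {v : ℕ × X | v.1 < n ∧ x ∈ closure (F v.1 v.2)}.Finite := by
      refine (((finite_lt_nat n).biUnion fun m hm =>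
        ((hF m hm).closure.point_finite x).image (Prod.mk m))).subset ?_
      rintro ⟨m, y⟩ ⟨hm, hy⟩
      exact mem_biUnion hm ⟨y, hy, rfl⟩
    have hfin' : {σ : Finset (ℕ × X) | ∀ v ∈ σ, v.1 < n ∧ x ∈ closure (F v.1 v.2)}.Finite := by
      refine (hfin.toFinset.powerset.finite_toSet).subset fun σ hσ => ?_
      exact Finset.mem_coe.2 (Finset.mem_powerset.2 fun v hv => hfin.mem_toFinset.2 (hσ v hv))
    refine (Filter.eventually_all_finite hfin').2 fun σ _ => ?_
    by_cases h : ContinuousOn H (geomSimplex (insert (n, x) σ)) ∧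
        MapsTo H (geomSimplex (insert (n, x) σ)) (φ σ.card x)
    · filter_upwards [(hφ σ.card _ ((isCompact_geomSimplex _).image_of_continuousOn h.1)).mem_nhds
        h.2.image_subset] with z hz _ _
      exact mapsTo_iff_image_subset.2 hz
    · exact .of_forall fun z h₁ h₂ => (h ⟨h₁, h₂⟩).elim

/-- The skeletal map `H` is continuous on every simplex whose vertices have different levels and
form a compatible chain of sets with a common point `z`, and takes this simplex into `φ k z`. -/
theorem CompatibleCover.continuousOn_and_mapsTo {X Y : Type*} [TopologicalSpace X] [DecidableEq X]
    [TopologicalSpace Y] {φ : ℕ → X → Set Y} {H : (ℕ × X → ℝ) → Y} {F : ℕ → X → Set X}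
    (hF : ∀ n, CompatibleCover φ H n F (F n))
    (hH : ∀ (n : ℕ) (x : X) (σ : Finset (ℕ × X)), (∀ v ∈ σ, v.1 < n) →
      ContinuousOn H (geomBoundary (insert (n, x) σ)) →
      MapsTo H (geomBoundary (insert (n, x) σ)) (φ (σ.card - 1) x) →
      ContinuousOn H (geomSimplex (insert (n, x) σ)) ∧
        MapsTo H (geomSimplex (insert (n, x) σ)) (φ σ.card x))
    (σ : Finset (ℕ × X)) : ∀ (n : ℕ) (x : X),
      (∀ v ∈ σ, v.1 < n ∧ x ∈ closure (F v.1 v.2)) → InjOn Prod.fst (σ : Set (ℕ × X)) →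
      ContinuousOn H (geomSimplex (insert (n, x) σ)) ∧
        MapsTo H (geomSimplex (insert (n, x) σ)) (φ σ.card x) := by
  induction σ using Finset.strongInduction with
  | H σ IH =>
    intro n x hσ hinj
    have hnσ : (n, x) ∉ σ := fun h => (hσ _ h).1.false
    have hface (v : ℕ × X) (hv : v ∈ insert (n, x) σ) :
        ContinuousOn H (geomSimplex ((insert (n, x) σ).erase v)) ∧
          MapsTo H (geomSimplex ((insert (n, x) σ).erase v)) (φ (σ.card - 1) x) := by
      rcases Finset.mem_insert.1 hv with rfl | hvσ
      · rw [Finset.erase_insert hnσ]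
        rcases σ.eq_empty_or_nonempty with rfl | hne
        · have : geomSimplex (∅ : Finset (ℕ × X)) = ∅ := by
            ext t
            simp [geomSimplex]
          simp [this, MapsTo]
        obtain ⟨⟨n', x'⟩, hτ, hmax⟩ := σ.exists_max_image Prod.fst hne
        have hx' := (hσ _ hτ).2
        have hτσ : ∀ v ∈ σ.erase (n', x'), v.1 < n' ∧ x' ∈ closure (F v.1 v.2) := by
          intro v hv
          obtain ⟨hvne, hvσ⟩ := Finset.mem_erase.1 hv
          have hlt : v.1 < n' := lt_of_le_of_ne (hmax v hvσ) fun h => hvne (hinj hvσ hτ h)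
          exact ⟨hlt, (hF n' x' x hx').1 _ hlt _ (hσ v hvσ).2⟩
        obtain ⟨h₁, h₂⟩ := IH _ (Finset.erase_ssubset hτ) n' x' hτσ
          (hinj.mono (by simp))
        have h₃ := (hF n' x' x hx').2 _ hτσ h₁ h₂
        rw [Finset.insert_erase hτ] at h₁ h₃
        rw [Finset.card_erase_of_mem hτ] at h₃
        exact ⟨h₁, h₃⟩
      · have hvn : (n, x) ≠ v := fun h => hnσ (h ▸ hvσ)
        rw [Finset.erase_insert_of_ne hvn, ← Finset.card_erase_of_mem hvσ]
        exact IH _ (Finset.erase_ssubset hvσ) n x (fun w hw => hσ w (Finset.mem_of_mem_erase hw))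
          (hinj.mono (by simp))
    refine hH n x σ (fun v hv => (hσ v hv).1) ?_ ?_
    · rw [geomBoundary_eq_iUnion]
      exact (locallyFinite_of_finite _).continuousOn_iUnion (fun _ => isClosed_geomSimplex _)
        fun v => (hface v v.2).1
    · rw [geomBoundary_eq_iUnion, mapsTo_iUnion]
      exact fun v => (hface v v.2).2

/-- In a C-space, every sequence of open covers `W n` is refined by a sequence of disjoint open
families indexed as the `W n`, which together cover the space. -/
theorem IsCSpace.exists_disjoint_refinement {X ι : Type*} [TopologicalSpace X] (hX : IsCSpace X)
    (W : ℕ → ι → Set X) (hWo : ∀ n i, IsOpen (W n i)) (hWc : ∀ n, ⋃ i, W n i = univ) :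
    ∃ G : ℕ × ι → Set X, (∀ v, IsOpen (G v)) ∧ (∀ v, G v ⊆ W v.1 v.2) ∧ ⋃ v, G v = univ ∧
      ∀ v w, v.1 = w.1 → v ≠ w → Disjoint (G v) (G w) := by
  obtain ⟨V, hVo, hVd, hVW, hVc⟩ := hX (fun n => range (W n)) fun n =>
    ⟨forall_mem_range.2 (hWo n), by rw [sUnion_range, hWc]⟩
  have hVW' : ∀ n, ∀ v : V n, ∃ i, (v : Set X) ⊆ W n i := by
    rintro n ⟨v, hv⟩
    obtain ⟨-, ⟨i, rfl⟩, hi⟩ := hVW n v hv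
    exact ⟨i, hi⟩
  choose c hc using hVW'
  refine ⟨fun p => ⋃ v : {v : V p.1 // c p.1 v = p.2}, (v.1 : Set X),
    fun p => isOpen_iUnion fun v => hVo _ _ v.1.2, ?_, ?_, ?_⟩
  · exact fun p => iUnion_subset fun v => (hc p.1 v.1).trans_eq (congrArg (W p.1) v.2)
  · refine iUnion_eq_univ_iff.2 fun x => ?_
    obtain ⟨n, v, hv, hx⟩ := mem_iUnion.1 (hVc.ge (mem_univ x))
    exact ⟨(n, c n ⟨v, hv⟩), mem_iUnion.2 ⟨⟨⟨v, hv⟩, rfl⟩, hx⟩⟩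
  · rintro ⟨n, i⟩ ⟨_, j⟩ rfl hij
    refine disjoint_iUnion_left.2 fun v => disjoint_iUnion_right.2 fun w => ?_
    refine hVd n v.1.2 w.1.2 fun hvw => hij ?_
    have : v.1 = w.1 := Subtype.ext hvw
    exact Prod.ext rfl (v.2.symm.trans ((congrArg (c n) this).trans w.2))

/-- A partition of unity at a point lies in the simplex spanned by any finite set containing its
support there. -/
theorem PartitionOfUnity.mem_geomSimplex {ι X : Type*} [TopologicalSpace X]
    (ρ : PartitionOfUnity ι X univ) (x : X) :
    (fun i => ρ i x) ∈ geomSimplex (ρ.finsupport x) :=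
  ⟨fun i => ρ.nonneg i x, fun i hi => by simpa using hi, ρ.sum_finsupport (mem_univ x)⟩

/-- The composition of a partition of unity with a map which is continuous on the simplices met by
the partition is continuous. -/
theorem PartitionOfUnity.continuous_comp_of_continuousOn_geomSimplex {ι X Y : Type*}
    [TopologicalSpace X] [TopologicalSpace Y] (ρ : PartitionOfUnity ι X univ) {H : (ι → ℝ) → Y}
    (hH : ∀ x, ContinuousOn H (geomSimplex (ρ.finsupport x))) :
    Continuous fun x => H fun i => ρ i x := by
  have hρ : Continuous fun x i => ρ i x := continuous_pi fun i => (ρ i).continuous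
  refine continuous_iff_continuousAt.2 fun x => ?_
  let S := {σ : (ρ.fintsupport x).powerset // ContinuousOn H (geomSimplex σ.1)}
  let C : S → Set X := fun σ => (fun x i => ρ i x) ⁻¹' geomSimplex σ.1.1
  have hC : ContinuousOn (fun x => H fun i => ρ i x) (⋃ σ, C σ) :=
    (locallyFinite_of_finite C).continuousOn_iUnion
      (fun σ => (isClosed_geomSimplex _).preimage hρ)
      fun σ => σ.2.comp hρ.continuousOn (mapsTo_preimage _ _)
  refine hC.continuousAt ?_
  filter_upwards [ρ.eventually_finsupport_subset (x₀ := x)] with z hz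
  exact mem_iUnion.2 ⟨⟨⟨_, Finset.mem_powerset.2 hz⟩, hH z⟩, ρ.mem_geomSimplex z⟩

/-- On a paracompact Hausdorff C-space, every aspherical sequence of lower locally
constant mappings admits a continuous selection for its union. -/
theorem asphericalSequence_selection_of_cSpace
    {X : Type*} [TopologicalSpace X] [T2Space X] [ParacompactSpace X]
    (hX : IsCSpace X)
    {Y : Type*} [TopologicalSpace Y] [T2Space Y] (φ : ℕ → X → Set Y)
    (hne : ∀ n x, (φ n x).Nonempty)
    (hllc : ∀ n, LowerLocallyConstant (φ n))
    (hasph : ∀ n x, EmbedIn n (φ n x) (φ (n + 1) x)) :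
    ∃ f : X → Y, Continuous f ∧ ∀ x, f x ∈ ⋃ n, φ n x := by
  classical
  rcases isEmpty_or_nonempty X with hX0 | ⟨⟨x₀⟩⟩
  · exact ⟨isEmptyElim, by fun_prop, isEmptyElim⟩
  have htop (σ : Finset (ℕ × X)) : ∃ x : X, ∀ v ∈ σ, (∀ w ∈ σ, w ≠ v → w.1 < v.1) → v.2 = x := by
    by_cases h : ∃ v ∈ σ, ∀ w ∈ σ, w ≠ v → w.1 < v.1
    · obtain ⟨v, hv, hv'⟩ := h
      refine ⟨v.2, fun w hw hw' => ?_⟩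
      by_contra hne
      have hvw : w ≠ v := fun h => hne (h ▸ rfl)
      exact lt_asymm (hw' v hv hvw.symm) (hv' w hw hvw)
    · exact ⟨x₀, fun v hv hv' => (h ⟨v, hv, hv'⟩).elim⟩
  choose top htop using htop
  obtain ⟨H, hH⟩ := exists_skeletal_extension (fun (σ : Finset (ℕ × X)) k => φ k (top σ))
    (fun σ => hne 0 _) (fun σ k => hasph k _)
  let α := {W : X → Set X // (∀ x, IsOpen (W x)) ∧ LocallyFinite W ∧ ⋃ x, W x = univ}
  have : Nonempty α := by
    obtain ⟨W, hW, -⟩ := exists_locallyFinite_cover_closure_subset (fun _ : X => univ)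
      fun _ => Filter.univ_mem
    exact ⟨⟨W, hW⟩⟩
  obtain ⟨W, hW⟩ := exists_seq_of_forall_exists_of_lt
    (fun n (F : ℕ → α) (a : α) => CompatibleCover φ H n (fun m => (F m).1) a.1)
    (fun n F => by
      obtain ⟨U, hU, hU'⟩ := exists_compatibleCover hllc H n (fun m => (F m).1)
        fun m _ => (F m).2.2.1
      exact ⟨⟨U, hU⟩, hU'⟩)
    (fun n F F' a hFF' h x z hz => by
      have hFF (m) (hm : m < n) : (F m).1 = (F' m).1 := congrArg Subtype.val (hFF' m hm)
      refine ⟨fun m hm => by simpa only [hFF m hm] using (h x z hz).1 m hm,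
        fun σ hσ => (h x z hz).2 σ fun v hv => ?_⟩
      simpa only [hFF v.1 (hσ v hv).1] using hσ v hv)
  have key := CompatibleCover.continuousOn_and_mapsTo hW fun n x σ hσ => by
    have hn : (n, x) ∉ σ := fun h => (hσ _ h).false
    have hx : x = top (insert (n, x) σ) := by
      refine htop _ (n, x) (Finset.mem_insert_self _ _) fun w hw hwn => hσ w ?_
      exact (Finset.mem_insert.1 hw).resolve_left hwn
    have := hH (insert (n, x) σ) σ.card (Finset.card_insert_of_notMem hn)
    rwa [← hx] at this
  obtain ⟨G, hGo, hGW, hGc, hGd⟩ := hX.exists_disjoint_refinement (fun n => (W n).1)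
    (fun n => (W n).2.1) fun n => (W n).2.2.2
  obtain ⟨ρ, hρ⟩ := PartitionOfUnity.exists_isSubordinate isClosed_univ G hGo hGc.ge
  have hchain (z : X) : ContinuousOn H (geomSimplex (ρ.finsupport z)) ∧
      ∃ k, MapsTo H (geomSimplex (ρ.finsupport z)) (φ k z) := by
    have hmem (v) (hv : v ∈ ρ.finsupport z) : z ∈ G v :=
      hρ v (subset_closure ((ρ.mem_finsupport z).1 hv))
    have hinj : InjOn Prod.fst (ρ.finsupport z : Set (ℕ × X)) := fun v hv w hw hvw =>
      by_contra fun h => disjoint_left.1 (hGd v w hvw h) (hmem v hv) (hmem w hw)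
    have hne : (ρ.finsupport z).Nonempty := by
      rw [Finset.nonempty_iff_ne_empty]
      intro h
      have := ρ.sum_finsupport (mem_univ z)
      simp [h] at this
    obtain ⟨⟨n, x⟩, hv, hmax⟩ := (ρ.finsupport z).exists_max_image Prod.fst hne
    have hz : z ∈ closure ((W n).1 x) := subset_closure (hGW _ (hmem _ hv))
    have hσ : ∀ w ∈ (ρ.finsupport z).erase (n, x), w.1 < n ∧ x ∈ closure ((W w.1).1 w.2) := by
      intro w hw
      obtain ⟨hwne, hw⟩ := Finset.mem_erase.1 hw
      have hlt : w.1 < n := lt_of_le_of_ne (hmax w hw) fun h => hwne (hinj hw hv h)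
      exact ⟨hlt, (hW n x z hz).1 _ hlt _ (subset_closure (hGW _ (hmem _ hw)))⟩
    obtain ⟨h₁, h₂⟩ := key _ n x hσ (hinj.mono (by simp))
    have h₃ := (hW n x z hz).2 _ hσ h₁ h₂
    rw [Finset.insert_erase hv] at h₁ h₃
    exact ⟨h₁, _, h₃⟩
  refine ⟨fun z => H fun i => ρ i z,
    ρ.continuous_comp_of_continuousOn_geomSimplex fun z => (hchain z).1, fun z => ?_⟩
  obtain ⟨k, hk⟩ := (hchain z).2
  exact mem_iUnion.2 ⟨k, hk (ρ.mem_geomSimplex z)⟩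
end

section
/- Let X be a paracompact Hausdorff space such that for every Hausdorff topological space Y, every aspherical sequence φ_n : X ⇝ Y (n < ω) of lower locally constant set-valued mappings admits a continuous selection for its union ⋃_{n<ω} φ_n. Then X is a C-space. -/
/-- Every open cover of a paracompact Hausdorff space has a σ-disjoint open refinement. -/
theorem exists_sigmaDisjoint_open_refinement {X : Type*} [TopologicalSpace X] [T2Space X]
    [ParacompactSpace X] (U : Set (Set X)) (hU : ∀ u ∈ U, IsOpen u) (hc : ⋃₀ U = Set.univ) :
    ∃ D : ℕ → Set (Set X), (∀ m, ∀ d ∈ D m, IsOpen d) ∧ (∀ m, (D m).Pairwise Disjoint) ∧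
      (∀ m, ∀ d ∈ D m, ∃ u ∈ U, d ⊆ u) ∧ (⋃ m, ⋃₀ D m) = Set.univ := by
  classical
  obtain ⟨p, hp⟩ := PartitionOfUnity.exists_isSubordinate isClosed_univ
    (fun u : U => (u : Set X)) (fun u => hU u u.2) (by rw [← Set.sUnion_eq_iUnion, hc])
  let W : Finset U → Set X := fun F => {x | ∀ i ∈ F, 0 < p i x ∧ ∀ j, j ∉ F → p j x < p i x}
  have hW : ∀ F, IsOpen (W F) := by
    intro F
    rw [isOpen_iff_mem_nhds]
    intro x hx
    obtain ⟨N, hN, hfin⟩ := p.locallyFinite x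
    have hlt : ∀ᶠ y in nhds x, ∀ i ∈ F, 0 < p i y ∧
        ∀ j ∈ hfin.toFinset, j ∉ F → p j y < p i y := by
      rw [Filter.eventually_all_finset]
      refine fun i hi => ((p i).continuous.continuousAt.eventually_const_lt (hx i hi).1).and ?_
      rw [Filter.eventually_all_finset]
      intro j _
      by_cases hj : j ∈ F
      · simp [hj]
      · filter_upwards [(p j).continuous.continuousAt.eventually_lt
          (p i).continuous.continuousAt ((hx i hi).2 j hj)] with y hy _ using hy
    filter_upwards [hN, hlt] with y hyN hy i hi
    refine ⟨(hy i hi).1, fun j hj => ?_⟩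
    by_cases h0 : p j y = 0
    · exact h0 ▸ (hy i hi).1
    · exact (hy i hi).2 j (hfin.mem_toFinset.2 ⟨y, h0, hyN⟩) hj
  refine ⟨fun m => {d | ∃ F : Finset U, F.card = m + 1 ∧ d = W F}, ?_, ?_, ?_, ?_⟩
  · rintro m _ ⟨F, -, rfl⟩
    exact hW F
  · rintro m _ ⟨F, hF, rfl⟩ _ ⟨G, hG, rfl⟩ hne
    rw [Set.disjoint_left]
    intro x hxF hxG
    refine hne (congrArg W ?_)
    by_contra hFG
    have h1 : ¬ F ⊆ G := fun h => hFG (Finset.eq_of_subset_of_card_le h (by omega))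
    have h2 : ¬ G ⊆ F := fun h => hFG (Finset.eq_of_subset_of_card_le h (by omega)).symm
    obtain ⟨i, hiF, hiG⟩ := Finset.not_subset.1 h1
    obtain ⟨j, hjG, hjF⟩ := Finset.not_subset.1 h2
    exact lt_asymm ((hxF i hiF).2 j hjF) ((hxG j hjG).2 i hiG)
  · rintro m _ ⟨F, hF, rfl⟩
    obtain ⟨i, hi⟩ : F.Nonempty := Finset.card_pos.1 (by omega)
    exact ⟨i, i.2, fun x hx => hp i (subset_tsupport _ (hx i hi).1.ne')⟩
  · refine Set.eq_univ_of_forall fun x => ?_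
    have hfin : {i | p i x ≠ 0}.Finite := p.locallyFinite.point_finite x
    obtain ⟨i, hi⟩ := p.exists_pos (Set.mem_univ x)
    have hcard : 0 < hfin.toFinset.card :=
      Finset.card_pos.2 ⟨i, hfin.mem_toFinset.2 hi.ne'⟩
    refine Set.mem_iUnion.2 ⟨hfin.toFinset.card - 1, W hfin.toFinset,
      ⟨hfin.toFinset, by omega, rfl⟩, fun k hk => ?_⟩
    have hk0 : 0 < p k x := (p.nonneg k x).lt_of_ne' (hfin.mem_toFinset.1 hk)
    refine ⟨hk0, fun j hj => ?_⟩
    have : p j x = 0 := by simpa using hj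
    rwa [this]

/-- The cone over a map defined on the unit sphere extends that map to the closed unit ball. -/
theorem exists_cone_extension {E Y : Type*} [NormedAddCommGroup E] [NormedSpace ℝ E]
    [FiniteDimensional ℝ E] [Nontrivial E] [AddCommGroup Y] [Module ℝ Y] [TopologicalSpace Y]
    [ContinuousAdd Y] [ContinuousSMul ℝ Y]
    (f : Metric.sphere (0 : E) 1 → Y) (hf : Continuous f) (e : Y) :
    ∃ g : Metric.closedBall (0 : E) 1 → Y, Continuous g ∧
      (∀ z, g (Set.inclusion Metric.sphere_subset_closedBall z) = f z) ∧
      ∀ z, ∃ s, ∃ t : ℝ, g z = t • f s + (1 - t) • e := by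
  let q : C(Metric.sphere (0 : E) 1 × Set.Icc (0 : ℝ) 1, Metric.closedBall (0 : E) 1) :=
    ⟨fun a => ⟨(a.2 : ℝ) • (a.1 : E), by
      have h1 := norm_eq_of_mem_sphere a.1
      simpa [norm_smul, h1, abs_of_nonneg a.2.2.1] using a.2.2.2⟩, by fun_prop⟩
  let h : C(Metric.sphere (0 : E) 1 × Set.Icc (0 : ℝ) 1, Y) :=
    ⟨fun a => (a.2 : ℝ) • f a.1 + (1 - (a.2 : ℝ)) • e, by fun_prop⟩
  have hsurj : Function.Surjective q := by
    rintro ⟨z, hz⟩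
    have hz1 : ‖z‖ ≤ 1 := by simpa using hz
    by_cases h0 : z = 0
    · obtain ⟨s, hs⟩ := (NormedSpace.sphere_nonempty (x := (0 : E)) (r := 1)).2 zero_le_one
      exact ⟨(⟨s, hs⟩, ⟨0, by simp⟩), by simp [q, h0]⟩
    · refine ⟨(⟨‖z‖⁻¹ • z, by simp [norm_smul, h0]⟩, ⟨‖z‖, norm_nonneg z, hz1⟩), ?_⟩
      simp [q, smul_smul, h0]
  have := FiniteDimensional.proper_real E
  have hq : Topology.IsQuotientMap q := .of_surjective_continuous hsurj q.continuous
  have hcomp : Function.FactorsThrough h q := by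
    rintro ⟨s, t, ht⟩ ⟨s', t', ht'⟩ hst
    have hst' : t • (s : E) = t' • (s' : E) := congrArg Subtype.val hst
    have htt : t = t' := by
      have := congrArg norm hst'
      simpa [norm_smul, norm_eq_of_mem_sphere, abs_of_nonneg ht.1, abs_of_nonneg ht'.1] using this
    subst htt
    by_cases h0 : t = 0
    · simp [h, h0]
    · have : s = s' := Subtype.ext (smul_right_injective E h0 hst')
      simp [h, this]
  have hlift : ∀ a, hq.lift h hcomp (q a) = h a := fun a =>
    DFunLike.congr_fun (hq.lift_comp h hcomp) a
  refine ⟨hq.lift h hcomp, (hq.lift h hcomp).continuous, fun z => ?_, fun z => ?_⟩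
  · have hz : Set.inclusion Metric.sphere_subset_closedBall z = q (z, ⟨1, by simp⟩) :=
      Subtype.ext (by simp [q])
    rw [hz, hlift]
    simp [h]
  · obtain ⟨a, rfl⟩ := hsurj z
    exact ⟨a.1, a.2, hlift a⟩

/-- `partialJoin W n x` consists of the nonzero functions on `ℕ × ℕ` whose support spans a simplex
of the join of the discrete sets `{m | x ∈ W k m}` with `k ≤ n`. -/
def partialJoin {X : Type*} (W : ℕ → ℕ → Set X) (n : ℕ) (x : X) : Set (ℕ × ℕ → ℝ) :=
  {y | (∃ a, y a ≠ 0) ∧ (∀ a, y a ≠ 0 → a.1 ≤ n ∧ x ∈ W a.1 a.2) ∧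
    ∀ a b, y a ≠ 0 → y b ≠ 0 → a.1 = b.1 → a = b}

theorem partialJoin_nonempty {X : Type*} {W : ℕ → ℕ → Set X}
    (hc : ∀ n, ⋃ m, W n m = Set.univ) (n : ℕ) (x : X) : (partialJoin W n x).Nonempty := by
  obtain ⟨m, hm⟩ := Set.iUnion_eq_univ_iff.1 (hc 0) x
  have key : ∀ a : ℕ × ℕ, (Pi.single (0, m) 1 : ℕ × ℕ → ℝ) a ≠ 0 → a = (0, m) := fun a ha => by
    by_contra hne
    exact ha (Pi.single_eq_of_ne hne _)
  refine ⟨Pi.single (0, m) 1, ⟨(0, m), by simp⟩, fun a ha => ?_, fun a b ha hb _ => ?_⟩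
  · rw [key a ha]
    exact ⟨Nat.zero_le n, hm⟩
  · rw [key a ha, key b hb]

theorem lowerLocallyConstant_partialJoin {X : Type*} [TopologicalSpace X] {W : ℕ → ℕ → Set X}
    (ho : ∀ n m, IsOpen (W n m)) (hfin : ∀ n x, {m | x ∈ W n m}.Finite) (n : ℕ) :
    LowerLocallyConstant (partialJoin W n) := by
  intro K _
  rw [isOpen_iff_mem_nhds]
  intro x hx
  have hS : {a : ℕ × ℕ | a.1 ≤ n ∧ x ∈ W a.1 a.2}.Finite := by
    refine ((Set.finite_Iic n).biUnion fun k _ => (hfin k x).image (Prod.mk k)).subset ?_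
    rintro ⟨k, m⟩ ⟨hk, hm⟩
    exact Set.mem_biUnion hk ⟨m, hm, rfl⟩
  have hev : ∀ᶠ z in nhds x, ∀ a ∈ {a : ℕ × ℕ | a.1 ≤ n ∧ x ∈ W a.1 a.2}, z ∈ W a.1 a.2 := by
    rw [Filter.eventually_all_finite hS]
    exact fun a ha => (ho a.1 a.2).mem_nhds ha.2
  filter_upwards [hev] with z hz y hy
  obtain ⟨h1, h2, h3⟩ := hx hy
  exact ⟨h1, fun a ha => ⟨(h2 a ha).1, hz a (h2 a ha)⟩, h3⟩

theorem embedIn_partialJoin {X : Type*} {W : ℕ → ℕ → Set X}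
    (hc : ∀ n, ⋃ m, W n m = Set.univ) (k n : ℕ) (x : X) :
    EmbedIn k (partialJoin W n x) (partialJoin W (n + 1) x) := by
  intro f hf hfS
  obtain ⟨m, hm⟩ := Set.iUnion_eq_univ_iff.1 (hc (n + 1)) x
  obtain ⟨g, hg, hgf, hgr⟩ := exists_cone_extension f hf (Pi.single (n + 1, m) 1)
  refine ⟨g, hg, ?_, hgf⟩
  rintro _ ⟨z, rfl⟩
  obtain ⟨s, t, hz⟩ := hgr z
  obtain ⟨⟨a, ha⟩, h2, h3⟩ := hfS ⟨s, rfl⟩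
  have hv : f s (n + 1, m) = 0 := by
    by_contra h
    exact absurd (h2 _ h).1 (by simp)
  have hgv : g z (n + 1, m) = 1 - t := by simp [hz, hv]
  have hgne : ∀ b, b ≠ (n + 1, m) → g z b = t * f s b := fun b hb => by simp [hz, hb]
  have hcase : ∀ b, g z b ≠ 0 → b = (n + 1, m) ∨ f s b ≠ 0 := fun b hb => by
    refine or_iff_not_imp_left.2 fun hne h0 => hb ?_
    rw [hgne b hne, h0, mul_zero]
  refine ⟨?_, fun b hb => ?_, fun b c hb hc hbc => ?_⟩
  · by_cases ht : t = 1
    · refine ⟨a, ?_⟩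
      rwa [hgne a (by rintro rfl; exact ha hv), ht, one_mul]
    · exact ⟨(n + 1, m), by rw [hgv]; exact sub_ne_zero.2 (Ne.symm ht)⟩
  · rcases hcase b hb with rfl | h
    · exact ⟨le_rfl, hm⟩
    · exact ⟨(h2 b h).1.trans n.le_succ, (h2 b h).2⟩
  · rcases hcase b hb with rfl | h <;> rcases hcase c hc with rfl | h'
    · rfl
    · have := (h2 c h').1
      simp only at hbc
      omega
    · have := (h2 b h).1
      simp only at hbc
      omega
    · exact h3 b c h h' hbc

/-- A paracompact Hausdorff space on which every aspherical sequence of lower locally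
constant mappings admits a continuous selection for its union is a C-space. -/
theorem cSpace_of_asphericalSequence_selection
    {X : Type*} [TopologicalSpace X] [T2Space X] [ParacompactSpace X]
    (hsel : ∀ (Y : Type) [TopologicalSpace Y] [T2Space Y] (φ : ℕ → X → Set Y),
      (∀ n x, (φ n x).Nonempty) →
      (∀ n, LowerLocallyConstant (φ n)) →
      (∀ n x, EmbedIn n (φ n x) (φ (n + 1) x)) →
      ∃ f : X → Y, Continuous f ∧ ∀ x, f x ∈ ⋃ n, φ n x) :
    IsCSpace X := by
  intro U hU
  choose D hDo hDd hDr hDc using fun n =>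
    exists_sigmaDisjoint_open_refinement (U n) (hU n).1 (hU n).2
  choose W hWo hWc hWf hWD using fun n =>
    precise_refinement (fun m => ⋃₀ D n m) (fun m => isOpen_sUnion (hDo n m)) (hDc n)
  obtain ⟨f, hf, hfφ⟩ := hsel (ℕ × ℕ → ℝ) (partialJoin W) (partialJoin_nonempty hWc)
    (lowerLocallyConstant_partialJoin hWo fun n x => (hWf n).point_finite x)
    fun n x => embedIn_partialJoin hWc n n x
  simp only [Set.mem_iUnion] at hfφ
  have hVo : ∀ n m, IsOpen {x | f x (n, m) ≠ 0} := fun n m =>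
    isOpen_ne_fun ((continuous_apply (n, m)).comp hf) continuous_const
  refine ⟨fun n => {v | ∃ m, ∃ d ∈ D n m, v = {x | f x (n, m) ≠ 0} ∩ d}, ?_, ?_, ?_, ?_⟩
  · rintro n _ ⟨m, d, hd, rfl⟩
    exact (hVo n m).inter (hDo n m d hd)
  · rintro n _ ⟨m, d, hd, rfl⟩ _ ⟨m', d', hd', rfl⟩ hne
    rw [Set.disjoint_left]
    rintro x ⟨hx, hxd⟩ ⟨hx', hxd'⟩
    obtain ⟨k, -, -, h3⟩ := hfφ x
    obtain rfl : m = m' := congrArg Prod.snd (h3 _ _ hx hx' rfl)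
    refine hne ?_
    rw [(hDd n m).eq hd hd' (Set.not_disjoint_iff.2 ⟨x, hxd, hxd'⟩)]
  · rintro n _ ⟨m, d, hd, rfl⟩
    obtain ⟨u, hu, hdu⟩ := hDr n m d hd
    exact ⟨u, hu, Set.inter_subset_right.trans hdu⟩
  · refine Set.eq_univ_of_forall fun x => ?_
    obtain ⟨k, ⟨⟨n, m⟩, ha⟩, h2, -⟩ := hfφ x
    obtain ⟨d, hd, hxd⟩ := hWD n m (h2 _ ha).2
    exact Set.mem_iUnion.2 ⟨n, _, ⟨m, d, hd, rfl⟩, ha, hxd⟩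
end

section
/- Let X be a paracompact Hausdorff space. Then X is a C-space if and only if for every Hausdorff topological space Y, every lower locally constant set-valued mapping Φ : X ⇝ Y such that Φ(x) is an aspherical subset of Y for every x ∈ X has a continuous selection. -/
/-- The closed simplex spanned by the finite vertex set `F`, as a set of weight functions. -/
def weightSimplex {ι : Type*} (F : Finset ι) : Set (ι → ℝ) :=
  {w | (∀ v, 0 ≤ w v) ∧ (∀ v ∉ F, w v = 0) ∧ ∑ v ∈ F, w v = 1}

theorem isClosed_weightSimplex {ι : Type*} (F : Finset ι) : IsClosed (weightSimplex F) := by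
  have : weightSimplex F = (⋂ v, {w : ι → ℝ | 0 ≤ w v}) ∩ ((⋂ v, ⋂ (_ : v ∉ F), {w | w v = 0}) ∩
      {w | ∑ v ∈ F, w v = 1}) := by
    ext w; simp [weightSimplex]
  rw [this]
  refine (isClosed_iInter fun v => isClosed_le continuous_const (continuous_apply v)).inter
    ((isClosed_iInter fun v => isClosed_iInter fun _ =>
      isClosed_eq (continuous_apply v) continuous_const).inter
      (isClosed_eq (by fun_prop) continuous_const))

theorem weightSimplex_le_one {ι : Type*} {F : Finset ι} {w : ι → ℝ} (hw : w ∈ weightSimplex F)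
    (v : ι) : w v ≤ 1 := by
  by_cases hv : v ∈ F
  · rw [← hw.2.2]
    exact Finset.single_le_sum (fun i _ => hw.1 i) hv
  · rw [hw.2.1 v hv]
    exact zero_le_one

theorem isCompact_weightSimplex {ι : Type*} (F : Finset ι) : IsCompact (weightSimplex F) :=
  (isCompact_univ_pi fun _ : ι => isCompact_Icc (a := (0 : ℝ)) (b := 1)).of_isClosed_subset
    (isClosed_weightSimplex F) fun _ hw v _ => ⟨hw.1 v, weightSimplex_le_one hw v⟩

theorem mem_weightSimplex_of_support {ι : Type*} {F F' : Finset ι} {w : ι → ℝ}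
    (hw : w ∈ weightSimplex F) (h : ∀ v ∉ F', w v = 0) : w ∈ weightSimplex F' := by
  classical
  refine ⟨hw.1, h, ?_⟩
  rw [← hw.2.2, Finset.sum_subset (Finset.subset_union_left (s₁ := F') (s₂ := F))
    (fun v _ hv => h v hv), Finset.sum_subset (Finset.subset_union_right (s₁ := F') (s₂ := F))
    (fun v _ hv => hw.2.1 v hv)]

theorem weightSimplex_mono {ι : Type*} {F F' : Finset ι} (h : F ⊆ F') :
    weightSimplex F ⊆ weightSimplex F' :=
  fun _ hw => mem_weightSimplex_of_support hw fun v hv => hw.2.1 v fun hv' => hv (h hv')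

theorem exists_ne_zero_of_mem_weightSimplex {ι : Type*} {F : Finset ι} {w : ι → ℝ}
    (hw : w ∈ weightSimplex F) : ∃ v ∈ F, w v ≠ 0 := by
  by_contra! h
  have := hw.2.2
  rw [Finset.sum_eq_zero h] at this
  exact zero_ne_one this

theorem continuous_div_norm_smul {E : Type*} [NormedAddCommGroup E] [NormedSpace ℝ E]
    {ρ : E → ℝ} (hρ : Continuous ρ) (h0 : ρ 0 = 0) :
    Continuous fun d : E => (ρ d / ‖d‖) • d := by
  rw [continuous_iff_continuousAt]
  intro d
  by_cases hd : d = 0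
  · subst hd
    rw [ContinuousAt, smul_zero]
    refine squeeze_zero_norm (a := fun d => ‖ρ d‖) (fun d => ?_) ?_
    · rw [norm_smul, norm_div, norm_norm]
      by_cases h : ‖d‖ = 0
      · simp [h]
      · rw [div_mul_cancel₀ _ h]
    · have := (hρ.norm).tendsto 0
      simpa [h0] using this
  · have : ContinuousAt (fun d : E => ‖d‖) d := continuous_norm.continuousAt
    exact (hρ.continuousAt.div this (norm_ne_zero_iff.2 hd)).smul continuousAt_id

/-- The barycentric displacement determined by the last `k + 1` of its `k + 2` coordinates. -/
def barycentricDisplacement {k : ℕ} (d : EuclideanSpace ℝ (Fin (k + 1))) : Fin (k + 2) → ℝ :=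
  Fin.cons (-∑ i, d i) d

/-- The largest decrease of a barycentric coordinate under a displacement. -/
noncomputable def maxDecrease {k : ℕ} (d : EuclideanSpace ℝ (Fin (k + 1))) : ℝ :=
  Finset.univ.sup' Finset.univ_nonempty fun j => -barycentricDisplacement d j

theorem sum_barycentricDisplacement {k : ℕ} (d : EuclideanSpace ℝ (Fin (k + 1))) :
    ∑ j, barycentricDisplacement d j = 0 := by
  simp [barycentricDisplacement, Fin.sum_univ_succ (n := k + 1)]

theorem barycentricDisplacement_smul {k : ℕ} (c : ℝ) (d : EuclideanSpace ℝ (Fin (k + 1)))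
    (j : Fin (k + 2)) : barycentricDisplacement (c • d) j = c * barycentricDisplacement d j := by
  refine Fin.cases ?_ (fun i => ?_) j
  · simp [barycentricDisplacement, Finset.mul_sum]
  · simp [barycentricDisplacement]

theorem continuous_barycentricDisplacement {k : ℕ} (j : Fin (k + 2)) :
    Continuous fun d : EuclideanSpace ℝ (Fin (k + 1)) => barycentricDisplacement d j := by
  refine Fin.cases ?_ (fun i => ?_) j
  · simp only [barycentricDisplacement, Fin.cons_zero]
    fun_prop
  · simp only [barycentricDisplacement, Fin.cons_succ]
    fun_prop

theorem continuous_maxDecrease {k : ℕ} :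
    Continuous (maxDecrease : EuclideanSpace ℝ (Fin (k + 1)) → ℝ) :=
  Continuous.finset_sup'_apply _ fun j _ => (continuous_barycentricDisplacement j).neg

theorem neg_le_maxDecrease {k : ℕ} (d : EuclideanSpace ℝ (Fin (k + 1))) (j : Fin (k + 2)) :
    -barycentricDisplacement d j ≤ maxDecrease d :=
  Finset.le_sup' (fun j => -barycentricDisplacement d j) (Finset.mem_univ j)

theorem exists_eq_maxDecrease {k : ℕ} (d : EuclideanSpace ℝ (Fin (k + 1))) :
    ∃ j, maxDecrease d = -barycentricDisplacement d j := by
  obtain ⟨j, -, hj⟩ := Finset.exists_mem_eq_sup' (Finset.univ_nonempty (α := Fin (k + 2)))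
    fun j => -barycentricDisplacement d j
  exact ⟨j, hj⟩

theorem maxDecrease_zero {k : ℕ} : maxDecrease (0 : EuclideanSpace ℝ (Fin (k + 1))) = 0 := by
  obtain ⟨j, hj⟩ := exists_eq_maxDecrease (0 : EuclideanSpace ℝ (Fin (k + 1)))
  have := barycentricDisplacement_smul 0 (0 : EuclideanSpace ℝ (Fin (k + 1))) j
  rw [zero_smul, zero_mul] at this
  rw [hj, this, neg_zero]

theorem maxDecrease_nonneg {k : ℕ} (d : EuclideanSpace ℝ (Fin (k + 1))) : 0 ≤ maxDecrease d := by
  by_contra! h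
  have h1 : ∀ j, 0 < barycentricDisplacement d j := fun j => by
    linarith [neg_le_maxDecrease d j]
  have h2 : 0 < ∑ j, barycentricDisplacement d j :=
    Finset.sum_pos (fun j _ => h1 j) Finset.univ_nonempty
  exact h2.ne (sum_barycentricDisplacement d).symm

theorem maxDecrease_pos {k : ℕ} {d : EuclideanSpace ℝ (Fin (k + 1))} (hd : d ≠ 0) :
    0 < maxDecrease d := by
  refine (maxDecrease_nonneg d).lt_of_ne fun h => hd ?_
  have h1 : ∀ j ∈ Finset.univ, 0 ≤ barycentricDisplacement d j := fun j _ => by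
    linarith [neg_le_maxDecrease d j]
  have h2 := (Finset.sum_eq_zero_iff_of_nonneg h1).1 (sum_barycentricDisplacement d)
  ext i
  simpa [barycentricDisplacement] using h2 i.succ (Finset.mem_univ _)

theorem maxDecrease_smul {k : ℕ} {c : ℝ} (hc : 0 ≤ c) (d : EuclideanSpace ℝ (Fin (k + 1))) :
    maxDecrease (c • d) = c * maxDecrease d := by
  apply le_antisymm
  · obtain ⟨j, hj⟩ := exists_eq_maxDecrease (c • d)
    rw [hj, barycentricDisplacement_smul, ← mul_neg]
    exact mul_le_mul_of_nonneg_left (neg_le_maxDecrease d j) hc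
  · obtain ⟨j, hj⟩ := exists_eq_maxDecrease d
    rw [hj, mul_neg, ← barycentricDisplacement_smul]
    exact neg_le_maxDecrease _ j

/-- A simplex of dimension `k + 1` maps to the ball so that its boundary is embedded in the sphere
with a left inverse defined on the whole sphere. -/
theorem exists_weightSimplex_ball_param {ι : Type*} {k : ℕ} {σ : Finset ι} (hσ : σ.card = k + 2) :
    ∃ (r : (ι → ℝ) → EuclideanSpace ℝ (Fin (k + 1)))
      (s : EuclideanSpace ℝ (Fin (k + 1)) → (ι → ℝ)),
      Continuous r ∧ (∀ w ∈ weightSimplex σ, ‖r w‖ ≤ 1) ∧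
      ContinuousOn s (Metric.sphere 0 1) ∧
      (∀ z ∈ Metric.sphere (0 : EuclideanSpace ℝ (Fin (k + 1))) 1,
        s z ∈ weightSimplex σ ∧ ∃ v ∈ σ, s z v = 0) ∧
      ∀ w ∈ weightSimplex σ, (∃ v ∈ σ, w v = 0) → ‖r w‖ = 1 ∧ s (r w) = w := by
  classical
  let e : Fin (k + 2) ≃ σ := (σ.equivFinOfCardEq hσ).symm
  set c : ℝ := k + 2 with hc
  have hc0 : 0 < c := by positivity
  have hsum : ∀ g : ι → ℝ, ∑ v ∈ σ, g v = ∑ j, g (e j) := fun g => by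
    rw [← Finset.sum_coe_sort σ g]
    exact (e.sum_comp fun v : σ => g v).symm
  let δ : (ι → ℝ) → EuclideanSpace ℝ (Fin (k + 1)) :=
    fun w => WithLp.toLp 2 fun i => w (e i.succ) - 1 / c
  have hδ : Continuous δ := by
    refine (PiLp.continuous_toLp 2 _).comp ?_
    fun_prop
  have hδL : ∀ w ∈ weightSimplex σ, ∀ j,
      barycentricDisplacement (δ w) j = w (e j) - 1 / c := by
    intro w hw j
    have hs := hw.2.2
    rw [hsum, Fin.sum_univ_succ] at hs
    refine Fin.cases ?_ (fun i => ?_) j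
    · simp only [barycentricDisplacement, Fin.cons_zero, δ, Finset.sum_sub_distrib,
        Finset.sum_const, Finset.card_univ, Fintype.card_fin, nsmul_eq_mul]
      push_cast
      rw [eq_sub_of_add_eq' hs]
      field_simp
      rw [hc]
      ring
    · simp [barycentricDisplacement, δ]
  let r : (ι → ℝ) → EuclideanSpace ℝ (Fin (k + 1)) :=
    fun w => ((c * maxDecrease (δ w)) / ‖δ w‖) • δ w
  let s : EuclideanSpace ℝ (Fin (k + 1)) → (ι → ℝ) := fun z v =>
    if h : v ∈ σ then 1 / c + barycentricDisplacement z (e.symm ⟨v, h⟩) / (c * maxDecrease z)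
    else 0
  have hse : ∀ z j, s z (e j) = 1 / c + barycentricDisplacement z j / (c * maxDecrease z) := by
    intro z j
    simp [s]
  have hr : ∀ w, δ w ≠ 0 → ‖r w‖ = c * maxDecrease (δ w) := by
    intro w hw
    have h1 := norm_pos_iff.2 hw
    have h2 := maxDecrease_nonneg (δ w)
    simp only [r]
    rw [norm_smul, Real.norm_of_nonneg (by positivity), div_mul_cancel₀ _ h1.ne']
  have hmem : ∀ v ∈ σ, ∃ j, ((e j : σ) : ι) = v := fun v hv => ⟨e.symm ⟨v, hv⟩, by simp⟩
  refine ⟨r, s, ?_, ?_, ?_, ?_, ?_⟩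
  · exact (continuous_div_norm_smul (ρ := fun d => c * maxDecrease d)
      (continuous_const.mul continuous_maxDecrease)
      (by rw [maxDecrease_zero, mul_zero])).comp hδ
  · intro w hw
    by_cases h0 : δ w = 0
    · simp [r, h0]
    · rw [hr w h0]
      obtain ⟨j, hj⟩ := exists_eq_maxDecrease (δ w)
      rw [hj, hδL w hw, neg_sub, mul_sub, mul_one_div_cancel hc0.ne']
      linarith [mul_nonneg hc0.le (hw.1 (e j))]
  · refine continuousOn_pi.2 fun v => ?_
    by_cases hv : v ∈ σ
    · simp only [s, hv, dite_true]
      refine continuousOn_const.add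
        ((continuous_barycentricDisplacement _).continuousOn.div
          (continuous_const.mul continuous_maxDecrease).continuousOn fun z hz => ?_)
      have := maxDecrease_pos (d := z) (ne_zero_of_mem_unit_sphere (⟨z, hz⟩ : Metric.sphere _ _))
      positivity
    · simp only [s, hv, dite_false]
      exact continuousOn_const
  · intro z hz
    have hz0 := maxDecrease_pos (d := z) (ne_zero_of_mem_unit_sphere (⟨z, hz⟩ : Metric.sphere _ _))
    refine ⟨⟨fun v => ?_, fun v hv => ?_, ?_⟩, ?_⟩
    · by_cases hv : v ∈ σ
      · obtain ⟨j, rfl⟩ := hmem v hv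
        have h : s z (e j) =
            (maxDecrease z + barycentricDisplacement z j) / (c * maxDecrease z) := by
          rw [hse]
          field_simp
        rw [h]
        have := neg_le_maxDecrease z j
        exact div_nonneg (by linarith) (by positivity)
      · simp [s, hv]
    · simp [s, hv]
    · rw [hsum]
      simp only [hse]
      rw [Finset.sum_add_distrib, ← Finset.sum_div _ (barycentricDisplacement z),
        sum_barycentricDisplacement]
      simp only [Finset.sum_const, Finset.card_univ, Fintype.card_fin, nsmul_eq_mul]
      push_cast
      rw [zero_div, add_zero, ← hc, mul_one_div_cancel hc0.ne']
    · obtain ⟨j, hj⟩ := exists_eq_maxDecrease z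
      refine ⟨e j, (e j).2, ?_⟩
      rw [hse, ← neg_eq_iff_eq_neg.2 hj]
      field_simp
      ring
  · rintro w hw ⟨v, hv, hwv⟩
    obtain ⟨j₀, rfl⟩ := hmem v hv
    have hmax : maxDecrease (δ w) = 1 / c := by
      apply le_antisymm
      · obtain ⟨j, hj⟩ := exists_eq_maxDecrease (δ w)
        rw [hj, hδL w hw]
        linarith [hw.1 (e j)]
      · have := neg_le_maxDecrease (δ w) j₀
        rw [hδL w hw, hwv] at this
        linarith
    have h0 : δ w ≠ 0 := fun h => by
      rw [h, maxDecrease_zero] at hmax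
      have : 0 < 1 / c := by positivity
      linarith
    have hn := norm_pos_iff.2 h0
    refine ⟨by rw [hr w h0, hmax, mul_one_div_cancel hc0.ne'], ?_⟩
    ext v
    by_cases hv : v ∈ σ
    · obtain ⟨j, rfl⟩ := hmem v hv
      rw [hse]
      simp only [r]
      rw [barycentricDisplacement_smul, hδL w hw, maxDecrease_smul (by rw [hmax]; positivity), hmax]
      field_simp
      ring
    · simp [s, hv, hw.2.1 v hv]

theorem exists_fill_weightSimplex {ι Y : Type*} [TopologicalSpace Y] {A : Set Y}
    (hne : A.Nonempty) (hA : ∀ k, EmbedIn k A A) {σ : Finset ι} (hσ : σ.Nonempty)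
    {H : (ι → ℝ) → Y} (hH : ContinuousOn H {w ∈ weightSimplex σ | ∃ v ∈ σ, w v = 0})
    (hHA : Set.MapsTo H {w ∈ weightSimplex σ | ∃ v ∈ σ, w v = 0} A) :
    ∃ G : (ι → ℝ) → Y, ContinuousOn G (weightSimplex σ) ∧ Set.MapsTo G (weightSimplex σ) A ∧
      Set.EqOn G H {w ∈ weightSimplex σ | ∃ v ∈ σ, w v = 0} := by
  obtain hcard | ⟨k, hk⟩ : σ.card = 1 ∨ ∃ k, σ.card = k + 2 := by
    have := hσ.card_pos
    obtain h | h := Nat.lt_or_ge σ.card 2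
    · left; omega
    · exact Or.inr ⟨σ.card - 2, by omega⟩
  · obtain ⟨v, rfl⟩ := Finset.card_eq_one.1 hcard
    obtain ⟨a, ha⟩ := hne
    refine ⟨fun _ => a, continuousOn_const, fun _ _ => ha, ?_⟩
    rintro w ⟨hw, u, hu, hwu⟩
    have := hw.2.2
    rw [Finset.mem_singleton] at hu
    rw [Finset.sum_singleton, ← hu, hwu] at this
    exact absurd this zero_ne_one
  · obtain ⟨r, s, hr, hr1, hs, hsσ, hrs⟩ := exists_weightSimplex_ball_param hk
    obtain ⟨g, hg, hgA, hgf⟩ := hA k (fun z => H (s z))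
      (hH.comp_continuous (continuousOn_iff_continuous_domRestrict.1 hs) fun z => hsσ z z.2)
      (Set.range_subset_iff.2 fun z => hHA (hsσ z z.2))
    have : Nonempty Y := ⟨hne.some⟩
    have hext : ∀ w, ∀ hw : w ∈ weightSimplex σ, Function.extend Subtype.val g (fun _ => hne.some)
        (r w) = g ⟨r w, by simpa using hr1 w hw⟩ := fun w hw =>
      Subtype.val_injective.extend_apply g (fun _ => hne.some) ⟨r w, by simpa using hr1 w hw⟩
    refine ⟨fun w => Function.extend Subtype.val g (fun _ => hne.some) (r w), ?_, ?_, ?_⟩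
    · rw [continuousOn_iff_continuous_domRestrict]
      have : (weightSimplex σ).domRestrict
          (fun w => Function.extend Subtype.val g (fun _ => hne.some) (r w)) =
          fun w : weightSimplex σ => g ⟨r w, by simpa using hr1 w w.2⟩ := by
        ext w
        exact hext w w.2
      rw [this]
      exact hg.comp ((hr.comp continuous_subtype_val).subtype_mk _)
    · intro w hw
      beta_reduce
      rw [hext w hw]
      exact hgA ⟨_, rfl⟩
    · rintro w ⟨hw, hw0⟩
      obtain ⟨h1, h2⟩ := hrs w hw hw0
      have := hgf ⟨r w, by simpa using h1⟩
      simp only [h2] at this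
      rw [← this]
      exact hext w hw

theorem exists_extension_weightSimplex {ι Y : Type*} [TopologicalSpace Y] {A : Set Y}
    (hne : A.Nonempty) (hA : ∀ k, EmbedIn k A A) (N : Finset ι) {𝓚 : Set (Finset ι)}
    (h𝓚 : IsLowerSet 𝓚) {H : (ι → ℝ) → Y}
    (hH : ∀ F ∈ 𝓚, ContinuousOn H (weightSimplex F) ∧ Set.MapsTo H (weightSimplex F) A) :
    ∃ G : (ι → ℝ) → Y, ContinuousOn G (weightSimplex N) ∧ Set.MapsTo G (weightSimplex N) A ∧
      ∀ F ∈ 𝓚, Set.EqOn G H (weightSimplex F) := by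
  classical
  obtain ⟨n, hn⟩ : ∃ n, (N.powerset.filter (· ∉ 𝓚)).card = n := ⟨_, rfl⟩
  induction n generalizing 𝓚 H with
  | zero =>
    have hN : N ∈ 𝓚 := by
      by_contra h
      rw [Finset.card_eq_zero] at hn
      exact Finset.notMem_empty N (hn ▸ Finset.mem_filter.2 ⟨Finset.mem_powerset_self N, h⟩)
    exact ⟨H, (hH N hN).1, (hH N hN).2, fun _ _ _ _ => rfl⟩
  | succ n ih =>
    have hne' : (N.powerset.filter (· ∉ 𝓚)).Nonempty := by
      rw [← Finset.card_pos]; omega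
    obtain ⟨σ, hσ, hmin⟩ := Finset.exists_min_image _ Finset.card hne'
    obtain ⟨hσN, hσ𝓚⟩ := Finset.mem_filter.1 hσ
    rw [Finset.mem_powerset] at hσN
    have hface : ∀ τ, τ ⊂ σ → τ ∈ 𝓚 := by
      intro τ hτ
      by_contra h
      exact (Finset.card_lt_card hτ).not_ge
        (hmin τ (Finset.mem_filter.2 ⟨Finset.mem_powerset.2 (hτ.subset.trans hσN), h⟩))
    have hbd : {w ∈ weightSimplex σ | ∃ v ∈ σ, w v = 0} =
        ⋃ v : σ, weightSimplex (σ.erase v) := by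
      ext w
      simp only [Set.mem_ofPred_eq, Set.mem_iUnion]
      constructor
      · rintro ⟨hw, v, hv, hwv⟩
        refine ⟨⟨v, hv⟩, mem_weightSimplex_of_support hw fun u hu => ?_⟩
        by_cases huv : u = v
        · rwa [huv]
        · exact hw.2.1 u fun huσ => hu (Finset.mem_erase.2 ⟨huv, huσ⟩)
      · rintro ⟨⟨v, hv⟩, hw⟩
        exact ⟨weightSimplex_mono (Finset.erase_subset _ _) hw, v, hv,
          hw.2.1 v (Finset.notMem_erase v σ)⟩
    obtain ⟨G, hGc, hGA, hGH⟩ : ∃ G : (ι → ℝ) → Y, ContinuousOn G (weightSimplex σ) ∧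
        Set.MapsTo G (weightSimplex σ) A ∧
        Set.EqOn G H {w ∈ weightSimplex σ | ∃ v ∈ σ, w v = 0} := by
      obtain rfl | hσne := σ.eq_empty_or_nonempty
      · have : weightSimplex (∅ : Finset ι) = ∅ := by
          ext w; simp [weightSimplex]
        simp only [this]
        exact ⟨H, continuousOn_empty _, Set.mapsTo_empty _ _, fun _ _ => rfl⟩
      · refine exists_fill_weightSimplex hne hA hσne ?_ ?_
        · rw [hbd]
          exact (locallyFinite_of_finite _).continuousOn_iUnion
            (fun v => isClosed_weightSimplex _)
            fun v => (hH _ (hface _ (Finset.erase_ssubset v.2))).1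
        · rw [hbd]
          intro w hw
          obtain ⟨v, hv⟩ := Set.mem_iUnion.1 hw
          exact (hH _ (hface _ (Finset.erase_ssubset v.2))).2 hv
    let H' : (ι → ℝ) → Y := fun w => if w ∈ weightSimplex σ then G w else H w
    have hH'σ : Set.EqOn H' G (weightSimplex σ) := fun w hw => if_pos hw
    have hH' : ∀ F ∈ 𝓚, Set.EqOn H' H (weightSimplex F) := by
      intro F hF w hw
      by_cases hwσ : w ∈ weightSimplex σ
      · rw [hH'σ hwσ]
        refine hGH ⟨hwσ, ?_⟩
        obtain ⟨v, hv, hvF⟩ := Finset.not_subset.1 fun h => hσ𝓚 (h𝓚 h hF)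
        exact ⟨v, hv, hw.2.1 v hvF⟩
      · exact if_neg hwσ
    have hcount : (N.powerset.filter (· ∉ insert σ 𝓚)).card = n := by
      have : N.powerset.filter (· ∉ insert σ 𝓚) = (N.powerset.filter (· ∉ 𝓚)).erase σ := by
        ext τ
        simp only [Finset.mem_filter, Finset.mem_erase, Set.mem_insert_iff]
        tauto
      rw [this, Finset.card_erase_of_mem hσ, hn, Nat.add_sub_cancel]
    have hlow : IsLowerSet (insert σ 𝓚) := by
      rintro F F' hF' (rfl | hF)
      · obtain h | h := eq_or_lt_of_le hF'
        · exact Or.inl h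
        · exact Or.inr (hface _ h)
      · exact Or.inr (h𝓚 hF' hF)
    obtain ⟨G', h1, h2, h3⟩ := ih (H := H') hlow (by
      rintro F (rfl | hF)
      · exact ⟨hGc.congr hH'σ, hGA.congr hH'σ.symm⟩
      · exact ⟨(hH F hF).1.congr (hH' F hF), (hH F hF).2.congr (hH' F hF).symm⟩) (by convert hcount)
    exact ⟨G', h1, h2, fun F hF => (h3 F (Or.inr hF)).trans (hH' F hF)⟩

/-- A finite set of indexed cells is transversal at `z` if it contains at most one cell of each
level and all its cells contain `z`. -/
structure IsTransversalAt {X : Type*} (C : ℕ → X → Set X) (z : X) (F : Finset (ℕ × X)) : Prop where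
  mem : ∀ v ∈ F, z ∈ C v.1 v.2
  injOn : Set.InjOn Prod.fst (F : Set (ℕ × X))

theorem IsTransversalAt.mono {X : Type*} {C : ℕ → X → Set X} {z : X} {F F' : Finset (ℕ × X)}
    (h : IsTransversalAt C z F) (hF : F' ⊆ F) : IsTransversalAt C z F' :=
  ⟨fun v hv => h.mem v (hF hv), h.injOn.mono (Finset.coe_subset.2 hF)⟩

/-- Locally finite closed covers of the levels below `n`, together with a map on the simplices of
these levels which sends every simplex transversal at `z` into `Φ z`. -/
structure IsPartialSelection {X Y : Type*} [TopologicalSpace X] [TopologicalSpace Y]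
    (Φ : X → Set Y) (n : ℕ) (C : ℕ → X → Set X) (H : (ℕ × X → ℝ) → Y) : Prop where
  isClosed : ∀ m < n, ∀ x, IsClosed (C m x)
  locallyFinite : ∀ m < n, LocallyFinite (C m)
  cover : ∀ m < n, ∀ z, ∃ x, z ∈ interior (C m x)
  continuousOn : ∀ z F, (∀ v ∈ F, v.1 < n) → IsTransversalAt C z F →
    ContinuousOn H (weightSimplex F)
  mapsTo : ∀ z F, (∀ v ∈ F, v.1 < n) → IsTransversalAt C z F →
    Set.MapsTo H (weightSimplex F) (Φ z)

theorem exists_locallyFinite_closed_refinement {X : Type*} [TopologicalSpace X] [T2Space X]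
    [ParacompactSpace X] {O : X → Set X} (hO : ∀ x, O x ∈ nhds x) :
    ∃ D : X → Set X, (∀ x, IsClosed (D x)) ∧ LocallyFinite D ∧ (∀ z, ∃ x, z ∈ interior (D x)) ∧
      ∀ x, D x ⊆ O x := by
  obtain ⟨v, hvo, hvc, hvf, hvO⟩ := precise_refinement (fun x => interior (O x))
    (fun _ => isOpen_interior)
    (Set.eq_univ_of_forall fun x => Set.mem_iUnion.2 ⟨x, mem_interior_iff_mem_nhds.2 (hO x)⟩)
  obtain ⟨w, hwc, hwo, hwv⟩ := exists_iUnion_eq_closure_subset hvo hvf.point_finite hvc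
  refine ⟨fun x => closure (w x), fun _ => isClosed_closure, hvf.subset hwv, fun z => ?_,
    fun x => (hwv x).trans ((hvO x).trans interior_subset)⟩
  obtain ⟨x, hx⟩ := Set.mem_iUnion.1 (hwc.ge (Set.mem_univ z))
  exact ⟨x, interior_maximal subset_closure (hwo x) hx⟩

theorem IsPartialSelection.exists_succ {X Y : Type*} [TopologicalSpace X] [T2Space X]
    [ParacompactSpace X] [TopologicalSpace Y] {Φ : X → Set Y} (hne : ∀ x, (Φ x).Nonempty)
    (hΦ : LowerLocallyConstant Φ) (hA : ∀ x, ∀ k : ℕ, EmbedIn k (Φ x) (Φ x)) {n : ℕ}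
    {C : ℕ → X → Set X} {H : (ℕ × X → ℝ) → Y} (h : IsPartialSelection Φ n C H) :
    ∃ (C' : ℕ → X → Set X) (H' : (ℕ × X → ℝ) → Y), IsPartialSelection Φ (n + 1) C' H' ∧
      (∀ m < n, C' m = C m) ∧ ∀ w : ℕ × X → ℝ, (∀ x, w (n, x) = 0) → H' w = H w := by
  classical
  have hfin : ∀ x, {v : ℕ × X | v.1 < n ∧ x ∈ C v.1 v.2}.Finite := by
    intro x
    have : (⋃ m ∈ Set.Iio n, Prod.mk m '' {u | x ∈ C m u}).Finite :=
      (Set.finite_Iio n).biUnion fun m hm => ((h.locallyFinite m hm).point_finite x).image _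
    refine this.subset ?_
    rintro ⟨m, u⟩ ⟨hm, hu⟩
    exact Set.mem_biUnion (show m ∈ Set.Iio n from hm) ⟨u, hu, rfl⟩
  let N : X → Finset (ℕ × X) := fun x => (hfin x).toFinset
  have hN : ∀ x v, v ∈ N x ↔ v.1 < n ∧ x ∈ C v.1 v.2 := fun x v => by simp [N]
  have hG : ∀ x, ∃ G : (ℕ × X → ℝ) → Y, ContinuousOn G (weightSimplex (insert (n, x) (N x))) ∧
      Set.MapsTo G (weightSimplex (insert (n, x) (N x))) (Φ x) ∧
      ∀ F ∈ {F | (∀ v ∈ F, v.1 < n) ∧ IsTransversalAt C x F},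
        Set.EqOn G H (weightSimplex F) := fun x =>
    exists_extension_weightSimplex (hne x) (hA x) _
      (𝓚 := {F | (∀ v ∈ F, v.1 < n) ∧ IsTransversalAt C x F})
      (fun F F' hF' hF => ⟨fun v hv => hF.1 v (hF' hv), hF.2.mono hF'⟩)
      (fun F hF => ⟨h.continuousOn x F hF.1 hF.2, h.mapsTo x F hF.1 hF.2⟩)
  choose G hGc hGΦ hGH using hG
  let O : X → Set X := fun x => {z | G x '' weightSimplex (insert (n, x) (N x)) ⊆ Φ z} ∩
    {z | N z ⊆ N x}
  have hO : ∀ x, O x ∈ nhds x := by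
    intro x
    refine Filter.inter_mem ?_ ?_
    · exact (hΦ _ ((isCompact_weightSimplex _).image_of_continuousOn (hGc x))).mem_nhds
        (hGΦ x).image_subset
    · have : ⋂ m ∈ Set.Iio n, (⋂ (u) (_ : x ∉ C m u), (C m u)ᶜ) ∈ nhds x :=
        (Filter.biInter_mem (Set.finite_Iio n)).2 fun m hm =>
          (h.locallyFinite m hm).iInter_compl_mem_nhds (h.isClosed m hm) x
      filter_upwards [this] with z hz v hv
      rw [hN] at hv ⊢
      refine ⟨hv.1, ?_⟩
      by_contra hx
      exact Set.mem_iInter₂.1 (Set.mem_iInter₂.1 hz v.1 hv.1) v.2 hx hv.2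
  obtain ⟨D, hDc, hDf, hDi, hDO⟩ := exists_locallyFinite_closed_refinement hO
  let C' : ℕ → X → Set X := Function.update C n D
  have hC'n : C' n = D := Function.update_self _ _ _
  have hC' : ∀ m < n, C' m = C m := fun m hm => Function.update_of_ne hm.ne _ _
  let H' : (ℕ × X → ℝ) → Y := fun w => if hw : ∃ x, w (n, x) ≠ 0 then G hw.choose w else H w
  have hH' : ∀ w : ℕ × X → ℝ, (∀ x, w (n, x) = 0) → H' w = H w := fun w hw =>
    dif_neg fun ⟨x, hx⟩ => hx (hw x)
  have key : ∀ z F, (∀ v ∈ F, v.1 < n + 1) → IsTransversalAt C' z F →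
      ContinuousOn H' (weightSimplex F) ∧ Set.MapsTo H' (weightSimplex F) (Φ z) := by
    intro z F hFn hF
    have hlow : ∀ F' ⊆ F, (∀ v ∈ F', v.1 < n) → IsTransversalAt C z F' := fun F' hF' hlt =>
      ⟨fun v hv => hC' v.1 (hlt v hv) ▸ (hF.mono hF').mem v hv, (hF.mono hF').injOn⟩
    by_cases hx : ∃ x, (n, x) ∈ F
    · obtain ⟨x, hx⟩ := hx
      have huniq : ∀ v ∈ F, v ≠ (n, x) → v.1 < n := by
        intro v hv hne
        refine lt_of_le_of_ne (Nat.lt_succ_iff.1 (hFn v hv)) fun h => hne ?_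
        exact hF.injOn hv hx h
      have hzO : z ∈ O x := hDO x (hC'n ▸ hF.mem _ hx)
      have hsub : F.erase (n, x) ⊆ N x := fun v hv => by
        obtain ⟨h1, h2⟩ := Finset.mem_erase.1 hv
        have h3 := huniq v h2 h1
        exact hzO.2 ((hN z v).2 ⟨h3, hC' v.1 h3 ▸ hF.mem v h2⟩)
      have hsub' : weightSimplex F ⊆ weightSimplex (insert (n, x) (N x)) :=
        weightSimplex_mono ((Finset.insert_erase hx).ge.trans (Finset.insert_subset_insert _ hsub))
      have heq : Set.EqOn H' (G x) (weightSimplex F) := by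
        intro w hw
        by_cases hwn : ∃ u, w (n, u) ≠ 0
        · have hu : hwn.choose = x := by
            have : (n, hwn.choose) ∈ F := by
              by_contra hu
              exact hwn.choose_spec (hw.2.1 _ hu)
            exact congrArg Prod.snd (hF.injOn this hx rfl)
          simp only [H', hwn, dite_true]
          rw [hu]
        · push Not at hwn
          rw [hH' w hwn]
          refine (hGH x (F.erase (n, x)) ⟨fun v hv => ?_, fun v hv => ?_, ?_⟩ ?_).symm
          · exact huniq v (Finset.mem_erase.1 hv).2 (Finset.mem_erase.1 hv).1
          · exact ((hN x v).1 (hsub hv)).2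
          · exact hF.injOn.mono (Finset.coe_subset.2 (Finset.erase_subset _ _))
          · refine mem_weightSimplex_of_support hw fun v hv => ?_
            by_cases hvx : v = (n, x)
            · rw [hvx]
              exact hwn x
            · exact hw.2.1 v fun hvF => hv (Finset.mem_erase.2 ⟨hvx, hvF⟩)
      refine ⟨((hGc x).mono hsub').congr heq, fun w hw => ?_⟩
      rw [heq hw]
      exact hzO.1 ⟨w, hsub' hw, rfl⟩
    · have hlt : ∀ v ∈ F, v.1 < n := fun v hv =>
        lt_of_le_of_ne (Nat.lt_succ_iff.1 (hFn v hv)) fun h => hx ⟨v.2, h ▸ hv⟩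
      have heq : Set.EqOn H' H (weightSimplex F) := fun w hw =>
        hH' w fun x => hw.2.1 _ fun hF => hx ⟨x, hF⟩
      have hF' := hlow F subset_rfl hlt
      exact ⟨(h.continuousOn z F hlt hF').congr heq, (h.mapsTo z F hlt hF').congr heq.symm⟩
  refine ⟨C', H', ⟨fun m hm => ?_, fun m hm => ?_, fun m hm => ?_,
    fun z F h1 h2 => (key z F h1 h2).1, fun z F h1 h2 => (key z F h1 h2).2⟩, hC', hH'⟩ <;>
  obtain hm | rfl := Nat.lt_succ_iff_lt_or_eq.1 hm
  · exact hC' m hm ▸ h.isClosed m hm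
  · exact hC'n ▸ hDc
  · exact hC' m hm ▸ h.locallyFinite m hm
  · exact hC'n ▸ hDf
  · exact hC' m hm ▸ h.cover m hm
  · exact hC'n ▸ hDi

theorem exists_coherent_covers {X Y : Type*} [TopologicalSpace X] [T2Space X]
    [ParacompactSpace X] [TopologicalSpace Y] [Nonempty Y] {Φ : X → Set Y}
    (hne : ∀ x, (Φ x).Nonempty)
    (hΦ : LowerLocallyConstant Φ) (hA : ∀ x, ∀ k : ℕ, EmbedIn k (Φ x) (Φ x)) :
    ∃ (C : ℕ → X → Set X) (H : (ℕ × X → ℝ) → Y), (∀ m z, ∃ x, z ∈ interior (C m x)) ∧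
      ∀ z F, IsTransversalAt C z F →
        ContinuousOn H (weightSimplex F) ∧ Set.MapsTo H (weightSimplex F) (Φ z) := by
  classical
  have h0 : IsPartialSelection Φ 0 (fun _ _ => Set.univ)
      (fun _ => Classical.arbitrary Y : (ℕ × X → ℝ) → Y) := by
    refine ⟨by simp, by simp, by simp, fun _ _ _ _ => continuousOn_const, fun z F hF _ w hw => ?_⟩
    obtain ⟨v, hv, -⟩ := exists_ne_zero_of_mem_weightSimplex hw
    exact absurd (hF v hv) (Nat.not_lt_zero _)
  have hstep : ∀ n (s : {s : (ℕ → X → Set X) × ((ℕ × X → ℝ) → Y) //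
      IsPartialSelection Φ n s.1 s.2}), ∃ t : {s : (ℕ → X → Set X) × ((ℕ × X → ℝ) → Y) //
      IsPartialSelection Φ (n + 1) s.1 s.2}, (∀ m < n, t.1.1 m = s.1.1 m) ∧
      ∀ w : ℕ × X → ℝ, (∀ x, w (n, x) = 0) → t.1.2 w = s.1.2 w := fun n s =>
    let ⟨C', H', h, h1, h2⟩ := s.2.exists_succ hne hΦ hA
    ⟨⟨(C', H'), h⟩, h1, h2⟩
  choose next hnextC hnextH using hstep
  let s₀ : {s : (ℕ → X → Set X) × ((ℕ × X → ℝ) → Y) // IsPartialSelection Φ 0 s.1 s.2} :=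
    ⟨(_, _), h0⟩
  let S : ∀ n, {s : (ℕ → X → Set X) × ((ℕ × X → ℝ) → Y) // IsPartialSelection Φ n s.1 s.2} :=
    fun n => Nat.rec s₀ next n
  have hS : ∀ n, S (n + 1) = next n (S n) := fun _ => rfl
  have hC : ∀ m n, m < n → (S n).1.1 m = (S (m + 1)).1.1 m := by
    intro m n hmn
    induction n, hmn using Nat.le_induction with
    | base => rfl
    | succ n hn ih => rw [hS, hnextC n _ m hn, ih]
  have hH : ∀ n n' (w : ℕ × X → ℝ), n ≤ n' → (∀ v : ℕ × X, n ≤ v.1 → w v = 0) →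
      (S n').1.2 w = (S n).1.2 w := by
    intro n n' w hn hw
    induction n', hn using Nat.le_induction with
    | base => rfl
    | succ n' hn ih => rw [hS, hnextH n' _ w fun x => hw _ hn, ih]
  let C : ℕ → X → Set X := fun m => (S (m + 1)).1.1 m
  let H : (ℕ × X → ℝ) → Y := fun w => (S (sInf {n | ∀ v : ℕ × X, n ≤ v.1 → w v = 0})).1.2 w
  refine ⟨C, H, fun m z => (S (m + 1)).2.cover m m.lt_succ_self z, fun z F hF => ?_⟩
  obtain ⟨n, hn⟩ : ∃ n, ∀ v ∈ F, v.1 < n :=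
    ⟨F.sup Prod.fst + 1, fun v hv => Nat.lt_succ_of_le (Finset.le_sup (f := Prod.fst) hv)⟩
  have hF' : IsTransversalAt (S n).1.1 z F :=
    ⟨fun v hv => hC v.1 n (hn v hv) ▸ hF.mem v hv, hF.injOn⟩
  have heq : Set.EqOn H (S n).1.2 (weightSimplex F) := by
    intro w hw
    have hmem : n ∈ {n | ∀ v : ℕ × X, n ≤ v.1 → w v = 0} := fun v hv =>
      hw.2.1 v fun h => (hn v h).not_ge hv
    exact (hH _ n w (Nat.sInf_le hmem) (Nat.sInf_mem ⟨n, hmem⟩)).symm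
  exact ⟨((S n).2.continuousOn z F hn hF').congr heq, ((S n).2.mapsTo z F hn hF').congr heq.symm⟩

theorem IsCSpace.exists_selection {X Y : Type*} [TopologicalSpace X] [T2Space X]
    [ParacompactSpace X] [TopologicalSpace Y] (hX : IsCSpace X) {Φ : X → Set Y}
    (hne : ∀ x, (Φ x).Nonempty) (hΦ : LowerLocallyConstant Φ)
    (hA : ∀ x, ∀ k : ℕ, EmbedIn k (Φ x) (Φ x)) : ∃ f : X → Y, Continuous f ∧ ∀ x, f x ∈ Φ x := by
  classical
  obtain hX0 | ⟨⟨x₀⟩⟩ := isEmpty_or_nonempty X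
  · exact ⟨fun x => isEmptyElim x, continuous_of_const fun x => isEmptyElim x,
      fun x => isEmptyElim x⟩
  have : Nonempty Y := ⟨(hne x₀).some⟩
  obtain ⟨C, H, hC, hH⟩ := exists_coherent_covers hne hΦ hA
  obtain ⟨V, hVo, hVd, hVr, hVc⟩ := hX (fun n => Set.range fun x => interior (C n x)) fun n =>
    ⟨by rintro _ ⟨x, rfl⟩; exact isOpen_interior, by
      refine Set.eq_univ_of_forall fun z => ?_
      obtain ⟨x, hx⟩ := hC n z
      exact ⟨_, ⟨x, rfl⟩, hx⟩⟩
  have hcell : ∀ n v, ∃ x, v ∈ V n → v ⊆ C n x := by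
    intro n v
    by_cases hv : v ∈ V n
    · obtain ⟨_, ⟨x, rfl⟩, hx⟩ := hVr n v hv
      exact ⟨x, fun _ => hx.trans interior_subset⟩
    · exact ⟨x₀, fun h => absurd h hv⟩
  choose c hc using hcell
  let W : ℕ × X → Set X := fun v => ⋃₀ {u ∈ V v.1 | c v.1 u = v.2}
  have hWC : ∀ v, W v ⊆ C v.1 v.2 := by
    rintro v z ⟨u, ⟨hu, hcu⟩, hz⟩
    exact hcu ▸ hc v.1 u hu hz
  have hWinj : ∀ z u v, z ∈ W u → z ∈ W v → u.1 = v.1 → u = v := by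
    rintro z ⟨n, x⟩ ⟨m, y⟩ ⟨u, ⟨hu, hcu⟩, hzu⟩ ⟨v, ⟨hv, hcv⟩, hzv⟩ (rfl : n = m)
    have : u = v := (hVd n).eq hu hv (Set.not_disjoint_iff.2 ⟨z, hzu, hzv⟩)
    rw [Prod.mk.injEq]
    exact ⟨rfl, hcu.symm.trans (this ▸ hcv)⟩
  obtain ⟨p, hp⟩ := PartitionOfUnity.exists_isSubordinate isClosed_univ W
    (fun v => isOpen_sUnion fun u hu => hVo _ u hu.1) (fun z _ => by
      obtain ⟨n, u, hu, hz⟩ := Set.mem_iUnion.1 (hVc.ge (Set.mem_univ z))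
      exact Set.mem_iUnion.2 ⟨(n, c n u), u, ⟨hu, rfl⟩, hz⟩)
  let P : X → (ℕ × X → ℝ) := fun z v => p v z
  have hP : Continuous P := continuous_pi fun v => (p v).continuous
  have hpW : ∀ z v, p v z ≠ 0 → z ∈ W v := fun z v h => hp v (subset_tsupport _ h)
  have hPz : ∀ z (I : Finset (ℕ × X)), P z ∈ weightSimplex I →
      P z ∈ weightSimplex (I.filter fun v => z ∈ W v) := fun z I hz =>
    mem_weightSimplex_of_support hz fun v hv => by
      by_contra h0
      exact hv (Finset.mem_filter.2
        ⟨by_contra fun h => h0 (hz.2.1 v h), hpW z v h0⟩)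
  have htrans : ∀ z (I : Finset (ℕ × X)), IsTransversalAt C z (I.filter fun v => z ∈ W v) :=
    fun z I => ⟨fun v hv => hWC v (Finset.mem_filter.1 hv).2, fun u hu v hv =>
      hWinj z u v (Finset.mem_filter.1 hu).2 (Finset.mem_filter.1 hv).2⟩
  have hloc : ∀ z₀, ∃ I : Finset (ℕ × X), ∀ᶠ z in nhds z₀, P z ∈ weightSimplex I := by
    intro z₀
    obtain ⟨I, hI⟩ := p.exists_finset_nhds z₀
    refine ⟨I, ?_⟩
    filter_upwards [hI] with z ⟨hz1, hz2⟩
    refine ⟨fun v => p.nonneg v z, fun v hv => ?_, hz1⟩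
    by_contra h0
    exact hv (hz2 h0)
  refine ⟨fun z => H (P z), ?_, fun z => ?_⟩
  · rw [continuous_iff_continuousAt]
    intro z₀
    obtain ⟨I, hI⟩ := hloc z₀
    let 𝓕 := {F : I.powerset // ∃ z, IsTransversalAt C z F.1}
    have hcont : ContinuousOn H (⋃ F : 𝓕, weightSimplex F.1.1) :=
      (locallyFinite_of_finite _).continuousOn_iUnion (fun _ => isClosed_weightSimplex _)
        fun F => (hH F.2.choose _ F.2.choose_spec).1
    have hmaps : ∀ᶠ z in nhds z₀, P z ∈ ⋃ F : 𝓕, weightSimplex F.1.1 := by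
      filter_upwards [hI] with z hz
      exact Set.mem_iUnion.2 ⟨⟨⟨I.filter fun v => z ∈ W v,
        Finset.mem_powerset.2 (Finset.filter_subset _ _)⟩, z, htrans z I⟩, hPz z I hz⟩
    exact (hcont _ hmaps.self_of_nhds).tendsto.comp
      (tendsto_nhdsWithin_iff.2 ⟨hP.continuousAt, hmaps⟩)
  · obtain ⟨I, hI⟩ := hloc z
    exact (hH z _ (htrans z I)).2 (hPz z I hI.self_of_nhds)

theorem exists_sigmaDisjoint_refinement {X : Type*} [TopologicalSpace X] [T2Space X]
    [ParacompactSpace X] {U : Set (Set X)} (hU : ∀ u ∈ U, IsOpen u) (hc : ⋃₀ U = Set.univ) :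
    ∃ W : ℕ → Set (Set X), (∀ k, ∀ w ∈ W k, IsOpen w) ∧ (∀ k, (W k).Pairwise Disjoint) ∧
      (∀ k, ∀ w ∈ W k, ∃ u ∈ U, w ⊆ u) ∧ ∀ x, ∃ k, x ∈ ⋃₀ W k := by
  classical
  obtain ⟨p, hp⟩ := PartitionOfUnity.exists_isSubordinate isClosed_univ (fun u : U => (u : Set X))
    (fun u => hU u u.2) (by rw [← Set.sUnion_eq_iUnion, hc])
  let D : Finset U → Set X := fun F => {x | ∀ i ∈ F, 0 < p i x ∧ ∀ j ∉ F, p j x < p i x}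
  have hD : ∀ F, IsOpen (D F) := by
    intro F
    rw [isOpen_iff_mem_nhds]
    intro x hx
    obtain ⟨I, hI⟩ := p.exists_finset_nhds x
    have h1 : ∀ᶠ y in nhds x, ∀ i ∈ F, 0 < p i y :=
      (Filter.eventually_all_finset F).2 fun i hi =>
        (p i).continuous.continuousAt.eventually (lt_mem_nhds (hx i hi).1)
    have h2 : ∀ᶠ y in nhds x, ∀ i ∈ F, ∀ j ∈ I \ F, p j y < p i y :=
      (Filter.eventually_all_finset F).2 fun i hi => (Filter.eventually_all_finset _).2 fun j hj =>
        (p j).continuous.continuousAt.eventually_lt (p i).continuous.continuousAt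
          ((hx i hi).2 j (Finset.mem_sdiff.1 hj).2)
    filter_upwards [hI, h1, h2] with y hy hy1 hy2 i hi
    refine ⟨hy1 i hi, fun j hj => ?_⟩
    by_cases hjI : j ∈ I
    · exact hy2 i hi j (Finset.mem_sdiff.2 ⟨hjI, hj⟩)
    · have : p j y = 0 := by
        by_contra h0
        exact hjI (hy.2 h0)
      rw [this]
      exact hy1 i hi
  refine ⟨fun k => D '' {F | F.Nonempty ∧ F.card = k}, ?_, ?_, ?_, ?_⟩
  · rintro k _ ⟨F, -, rfl⟩
    exact hD F
  · rintro k _ ⟨F, ⟨-, hF⟩, rfl⟩ _ ⟨F', ⟨-, hF'⟩, rfl⟩ hne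
    have hFF' : F ≠ F' := fun h => hne (h ▸ rfl)
    obtain ⟨i, hi, hi'⟩ := Finset.not_subset.1 fun h =>
      hFF' (Finset.eq_of_subset_of_card_le h (hF'.trans hF.symm).le)
    obtain ⟨j, hj, hj'⟩ := Finset.not_subset.1 fun h =>
      hFF' (Finset.eq_of_subset_of_card_le h (hF.trans hF'.symm).le).symm
    exact Set.disjoint_left.2 fun x hx hx' =>
      lt_asymm ((hx i hi).2 j hj') ((hx' j hj).2 i hi')
  · rintro k _ ⟨F, ⟨⟨i, hi⟩, -⟩, rfl⟩
    exact ⟨i, i.2, fun x hx => hp i (subset_tsupport _ (hx i hi).1.ne')⟩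
  · intro x
    obtain ⟨i, hi⟩ := p.exists_pos (Set.mem_univ x)
    refine ⟨_, D (p.finsupport x), ⟨p.finsupport x, ⟨⟨i, ?_⟩, rfl⟩, rfl⟩, fun i hi => ?_⟩
    · rw [PartitionOfUnity.mem_finsupport]
      exact hi.ne'
    · rw [PartitionOfUnity.mem_finsupport] at hi
      have hpos : 0 < p i x := (p.nonneg i x).lt_of_ne' hi
      refine ⟨hpos, fun j hj => ?_⟩
      rw [PartitionOfUnity.mem_finsupport, Function.notMem_support] at hj
      rwa [hj]

/-- The infinite join of countably many countable discrete sets: finitely supported systems of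
barycentric coordinates with at most one nonzero coordinate in each level. -/
def DiscreteJoin : Type :=
  {w : ℕ × ℕ → ℝ // (∃ F, w ∈ weightSimplex F) ∧ Set.InjOn Prod.fst (Function.support w)}

namespace DiscreteJoin

/-- The points of the join supported in a finite set of vertices. -/
def Sub (F : Finset (ℕ × ℕ)) : Type :=
  {w : ℕ × ℕ → ℝ // w ∈ weightSimplex F ∧ Set.InjOn Prod.fst (Function.support w)}

instance (F : Finset (ℕ × ℕ)) : TopologicalSpace (Sub F) :=
  inferInstanceAs (TopologicalSpace
    {w : ℕ × ℕ → ℝ // w ∈ weightSimplex F ∧ Set.InjOn Prod.fst (Function.support w)})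

instance (F : Finset (ℕ × ℕ)) : T1Space (Sub F) :=
  inferInstanceAs (T1Space
    {w : ℕ × ℕ → ℝ // w ∈ weightSimplex F ∧ Set.InjOn Prod.fst (Function.support w)})

/-- The inclusion of a finite subcomplex of the join. -/
def incl (F : Finset (ℕ × ℕ)) (w : Sub F) : DiscreteJoin :=
  ⟨w.1, ⟨F, w.2.1⟩, w.2.2⟩

/-- The weak topology determined by the finite subcomplexes. -/
instance : TopologicalSpace DiscreteJoin :=
  ⨆ F : Finset (ℕ × ℕ), TopologicalSpace.coinduced (incl F) inferInstance

theorem continuous_incl (F : Finset (ℕ × ℕ)) : Continuous (incl F) :=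
  continuous_iff_coinduced_le.2 (le_iSup (fun F : Finset (ℕ × ℕ) =>
    TopologicalSpace.coinduced (incl F) inferInstance) F)

theorem continuous_val : Continuous fun y : DiscreteJoin => y.1 :=
  continuous_iSup_dom.2 fun _ => continuous_coinduced_dom.2 continuous_subtype_val

theorem continuous_coord (v : ℕ × ℕ) : Continuous fun y : DiscreteJoin => y.1 v :=
  (continuous_apply v).comp continuous_val

instance : T2Space DiscreteJoin :=
  T2Space.of_injective_continuous Subtype.val_injective continuous_val

theorem isClosed_iff {A : Set DiscreteJoin} :
    IsClosed A ↔ ∀ F, IsClosed (incl F ⁻¹' A) := by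
  rw [isClosed_iSup_iff]
  exact forall_congr' fun F => isClosed_coinduced

theorem isClosed_of_finite_inter {A : Set DiscreteJoin}
    (h : ∀ F : Finset (ℕ × ℕ), {y ∈ A | ∀ v ∉ F, y.1 v = 0}.Finite) : IsClosed A :=
  isClosed_iff.2 fun F => by
    have hinj : Function.Injective (incl F) := fun a b hab =>
      Subtype.ext (congrArg (Subtype.val : DiscreteJoin → _) hab)
    refine Set.Finite.isClosed (Set.Finite.subset ((h F).preimage hinj.injOn) ?_)
    exact fun w hw => ⟨hw, w.2.1.2.1⟩

theorem finite_support (y : DiscreteJoin) : (Function.support y.1).Finite := by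
  obtain ⟨F, hF⟩ := y.2.1
  exact F.finite_toSet.subset fun v hv => by_contra fun h => hv (hF.2.1 v h)

/-- A compact subset of the join lies in a finite subcomplex. -/
theorem finite_vertices_of_isCompact {K : Set DiscreteJoin} (hK : IsCompact K) :
    {v | ∃ y ∈ K, y.1 v ≠ 0}.Finite := by
  set T := {v | ∃ y ∈ K, y.1 v ≠ 0} with hT
  obtain rfl | ⟨y₀, -⟩ := K.eq_empty_or_nonempty
  · simp [hT]
  have : Nonempty DiscreteJoin := ⟨y₀⟩
  choose! y hyK hy using fun v (hv : v ∈ T) => hv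
  have hclosed : ∀ A ⊆ y '' T, IsClosed A := by
    intro A hA
    refine isClosed_of_finite_inter fun F => (F.finite_toSet.image y).subset ?_
    rintro z ⟨hz, hzF⟩
    obtain ⟨v, hv, rfl⟩ := hA hz
    exact ⟨v, by_contra fun h => hy v hv (hzF v h), rfl⟩
  have hfin : (y '' T).Finite := by
    refine (hK.of_isClosed_subset (hclosed _ subset_rfl) (Set.image_subset_iff.2 hyK)).finite ?_
    rw [isDiscrete_iff_discreteTopology, discreteTopology_subtype_iff']
    intro z hz
    refine ⟨(y '' T \ {z})ᶜ, (hclosed _ Set.sdiff_subset).isOpen_compl, ?_⟩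
    ext u
    simp only [Set.mem_inter_iff, Set.mem_compl_iff, Set.mem_sdiff, Set.mem_singleton_iff]
    constructor
    · rintro ⟨h1, h2⟩
      by_contra h
      exact h1 ⟨h2, h⟩
    · rintro rfl
      exact ⟨fun h => h.2 rfl, hz⟩
  refine (hfin.biUnion fun z _ => z.finite_support).subset fun v hv => ?_
  exact Set.mem_biUnion (Set.mem_image_of_mem y hv) (hy v hv)

end DiscreteJoin

theorem continuous_norm_mul_comp_normalize {E : Type*} [NormedAddCommGroup E] [NormedSpace ℝ E]
    {π : E → Metric.sphere (0 : E) 1} (hπ : ∀ z ≠ 0, (π z : E) = ‖z‖⁻¹ • z)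
    {φ : Metric.sphere (0 : E) 1 → ℝ} (hφ : Continuous φ) (hb : ∀ z, |φ z| ≤ 1) :
    Continuous fun z => ‖z‖ * φ (π z) := by
  rw [continuous_iff_continuousAt]
  intro z
  by_cases hz : z = 0
  · subst hz
    rw [ContinuousAt, norm_zero, zero_mul]
    refine squeeze_zero_norm (a := fun z => ‖z‖) (fun z => ?_) ?_
    · rw [norm_mul, norm_norm]
      exact mul_le_of_le_one_right (norm_nonneg _) (hb _)
    · simpa using (continuous_norm (E := E)).tendsto 0
  · refine continuous_norm.continuousAt.mul (hφ.continuousAt.comp ?_)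
    rw [ContinuousAt, Topology.IsInducing.subtypeVal.tendsto_nhds_iff]
    have h1 : ContinuousAt (fun z : E => ‖z‖⁻¹ • z) z :=
      (continuous_norm.continuousAt.inv₀ (norm_ne_zero_iff.2 hz)).smul continuousAt_id
    have h2 : (fun z : E => ‖z‖⁻¹ • z) =ᶠ[nhds z] Subtype.val ∘ π := by
      filter_upwards [isOpen_ne.mem_nhds hz] with u hu
      exact (hπ u hu).symm
    have h3 := h1.congr h2
    exact h3

namespace DiscreteJoin

theorem embedIn_of_exists_level {G : ℕ → ℕ → Prop} (hG : ∀ n, ∃ j, G n j) (k : ℕ) :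
    EmbedIn k {y : DiscreteJoin | ∀ v, y.1 v ≠ 0 → G v.1 v.2}
      {y : DiscreteJoin | ∀ v, y.1 v ≠ 0 → G v.1 v.2} := by
  classical
  intro f hf hfG
  have hT := finite_vertices_of_isCompact (isCompact_range hf)
  set T : Finset (ℕ × ℕ) := hT.toFinset with hTdef
  have hfT : ∀ z v, (f z).1 v ≠ 0 → v ∈ T := fun z v hv =>
    hT.mem_toFinset.2 ⟨f z, ⟨z, rfl⟩, hv⟩
  obtain ⟨j, hj⟩ := hG (T.sup Prod.fst + 1)
  set a : ℕ × ℕ := (T.sup Prod.fst + 1, j) with ha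
  have haT : ∀ v ∈ T, v.1 ≠ a.1 := fun v hv =>
    (Nat.lt_succ_of_le (Finset.le_sup (f := Prod.fst) hv)).ne
  have hfa : ∀ z, (f z).1 a = 0 := fun z => by_contra fun h => haT a (hfT z a h) rfl
  have hfs : ∀ z, (f z).1 ∈ weightSimplex T := fun z =>
    mem_weightSimplex_of_support (f z).2.1.choose_spec fun v hv => by_contra fun h => hv (hfT z v h)
  let z₀ : Metric.sphere (0 : EuclideanSpace ℝ (Fin (k + 1))) 1 :=
    ⟨EuclideanSpace.single 0 1, by simp⟩
  let π : EuclideanSpace ℝ (Fin (k + 1)) → Metric.sphere (0 : EuclideanSpace ℝ (Fin (k + 1))) 1 :=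
    fun z => if hz : z = 0 then z₀ else ⟨‖z‖⁻¹ • z, by
      rw [mem_sphere_zero_iff_norm, norm_smul, norm_inv, norm_norm,
        inv_mul_cancel₀ (norm_ne_zero_iff.2 hz)]⟩
  have hπ : ∀ z ≠ 0, (π z : EuclideanSpace ℝ (Fin (k + 1))) = ‖z‖⁻¹ • z := fun z hz => by
    simp [π, hz]
  let c : EuclideanSpace ℝ (Fin (k + 1)) → (ℕ × ℕ → ℝ) := fun z v =>
    ‖z‖ * (f (π z)).1 v + (1 - ‖z‖) * (Pi.single a 1 : ℕ × ℕ → ℝ) v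
  have hc : Continuous c := continuous_pi fun v =>
    (continuous_norm_mul_comp_normalize hπ ((continuous_coord v).comp hf) fun z => by
      rw [Function.comp_apply, abs_of_nonneg ((hfs z).1 v)]
      exact weightSimplex_le_one (hfs z) v).add
      ((continuous_const.sub continuous_norm).mul continuous_const)
  have hcsupp : ∀ z v, c z v ≠ 0 → (f (π z)).1 v ≠ 0 ∨ v = a := by
    intro z v hv
    by_contra! h
    exact hv (by simp [c, h.1, Pi.single_eq_of_ne h.2])
  have hcmem : ∀ z : EuclideanSpace ℝ (Fin (k + 1)), ‖z‖ ≤ 1 → c z ∈ weightSimplex (insert a T) ∧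
      Set.InjOn Prod.fst (Function.support (c z)) := by
    intro z hz
    have haT' : a ∉ T := fun h => haT a h rfl
    refine ⟨⟨fun v => ?_, fun v hv => ?_, ?_⟩, ?_⟩
    · have h1 : (0 : ℝ) ≤ (Pi.single a 1 : ℕ × ℕ → ℝ) v := by
        by_cases h : v = a
        · simp [h]
        · simp [Pi.single_eq_of_ne h]
      have := mul_nonneg (norm_nonneg z) ((hfs (π z)).1 v)
      have := mul_nonneg (sub_nonneg.2 hz) h1
      simp only [c]
      linarith
    · by_contra h
      obtain h | h := hcsupp z v h
      · exact hv (Finset.mem_insert_of_mem (hfT _ _ h))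
      · exact hv (h ▸ Finset.mem_insert_self a T)
    · simp only [c]
      rw [Finset.sum_add_distrib, ← Finset.mul_sum, ← Finset.mul_sum, Finset.sum_insert haT', hfa,
        (hfs (π z)).2.2, Finset.sum_pi_single']
      simp
    · intro u hu v hv huv
      obtain hu | hu := hcsupp z u hu <;> obtain hv | hv := hcsupp z v hv
      · exact (f (π z)).2.2 hu hv huv
      · exact absurd (huv.trans (by rw [hv])) (haT u (hfT _ _ hu))
      · exact absurd (huv.symm.trans (by rw [hu])) (haT v (hfT _ _ hv))
      · rw [hu, hv]
  refine ⟨fun z => incl (insert a T) ⟨c z, hcmem z (mem_closedBall_zero_iff.1 z.2)⟩, ?_, ?_,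
    fun z => ?_⟩
  · exact (continuous_incl _).comp ((hc.comp continuous_subtype_val).subtype_mk _)
  · rintro _ ⟨z, rfl⟩ v hv
    obtain h | h := hcsupp z v hv
    · exact hfG ⟨π z, rfl⟩ v h
    · rw [h]
      exact hj
  · apply Subtype.ext
    have hz : ‖(z : EuclideanSpace ℝ (Fin (k + 1)))‖ = 1 :=
      mem_sphere_zero_iff_norm.1 z.2
    have hπz : π z = z := by
      apply Subtype.ext
      rw [hπ _ (ne_zero_of_mem_unit_sphere z), hz, inv_one, one_smul]
    ext v
    change c z v = (f z).1 v
    simp only [c]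
    rw [hz, hπz]
    ring

end DiscreteJoin

theorem isCSpace_of_exists_selection {X : Type*} [TopologicalSpace X] [T2Space X]
    [ParacompactSpace X]
    (h : ∀ Φ : X → Set DiscreteJoin, (∀ x, (Φ x).Nonempty) → LowerLocallyConstant Φ →
      (∀ x, ∀ k : ℕ, EmbedIn k (Φ x) (Φ x)) → ∃ f : X → DiscreteJoin, Continuous f ∧
        ∀ x, f x ∈ Φ x) : IsCSpace X := by
  classical
  intro U hU
  choose W hWo hWd hWr hWc using fun n => exists_sigmaDisjoint_refinement (hU n).1 (hU n).2
  let Φ : X → Set DiscreteJoin := fun x => {y | ∀ v, y.1 v ≠ 0 → x ∈ ⋃₀ W v.1 v.2}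
  have hne : ∀ x, (Φ x).Nonempty := by
    intro x
    obtain ⟨k, hk⟩ := hWc 0 x
    have hs : ∀ v, (Pi.single (0, k) 1 : ℕ × ℕ → ℝ) v ≠ 0 → v = (0, k) := fun v hv => by
      by_contra hne
      exact hv (Pi.single_eq_of_ne hne _)
    refine ⟨⟨Pi.single (0, k) 1, ⟨{(0, k)}, fun v => ?_, fun v hv => ?_, by simp⟩, ?_⟩, ?_⟩
    · by_cases hv : v = (0, k)
      · simp [hv]
      · rw [Pi.single_eq_of_ne hv]
    · exact Pi.single_eq_of_ne (Finset.notMem_singleton.1 hv) _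
    · intro u hu v hv _
      rw [hs u hu, hs v hv]
    · intro v hv
      rw [hs v hv]
      exact hk
  have hΦ : LowerLocallyConstant Φ := by
    intro K hK
    have : {x | K ⊆ Φ x} = ⋂ v ∈ {v | ∃ y ∈ K, y.1 v ≠ 0}, ⋃₀ W v.1 v.2 := by
      ext x
      rw [Set.mem_iInter₂]
      exact ⟨fun hx v ⟨y, hy, hyv⟩ => hx hy v hyv, fun hx y hy v hv => hx v ⟨y, hy, hv⟩⟩
    rw [this]
    exact (DiscreteJoin.finite_vertices_of_isCompact hK).isOpen_biInter fun v _ =>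
      isOpen_sUnion (hWo v.1 v.2)
  obtain ⟨f, hf, hfΦ⟩ := h Φ hne hΦ fun x k =>
    DiscreteJoin.embedIn_of_exists_level (fun n => hWc n x) k
  refine ⟨fun n => {s | ∃ k, ∃ w ∈ W n k, s = {x | (f x).1 (n, k) ≠ 0} ∩ w}, ?_, ?_, ?_, ?_⟩
  · rintro n _ ⟨k, w, hw, rfl⟩
    exact (isOpen_ne_fun ((DiscreteJoin.continuous_coord (n, k)).comp hf) continuous_const).inter
      (hWo n k w hw)
  · rintro n _ ⟨k, w, hw, rfl⟩ _ ⟨k', w', hw', rfl⟩ hne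
    rw [Set.disjoint_left]
    rintro x ⟨hx, hxw⟩ ⟨hx', hxw'⟩
    obtain rfl : k = k' := congrArg Prod.snd ((f x).2.2 hx hx' rfl)
    have : w ≠ w' := fun h => hne (h ▸ rfl)
    exact Set.disjoint_left.1 (hWd n k hw hw' this) hxw hxw'
  · rintro n _ ⟨k, w, hw, rfl⟩
    obtain ⟨u, hu, hwu⟩ := hWr n k w hw
    exact ⟨u, hu, Set.inter_subset_right.trans hwu⟩
  · refine Set.eq_univ_of_forall fun x => ?_
    obtain ⟨F, hF⟩ := (f x).2.1
    obtain ⟨⟨n, k⟩, -, hv⟩ := exists_ne_zero_of_mem_weightSimplex hF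
    obtain ⟨w, hw, hxw⟩ := hfΦ x (n, k) hv
    exact Set.mem_iUnion.2 ⟨n, _, ⟨k, w, hw, rfl⟩, hv, hxw⟩

/-- Uspenskij's theorem: a paracompact Hausdorff space is a C-space iff every lower
locally constant aspherical-valued mapping into any Hausdorff space has a
continuous selection. -/
theorem cSpace_iff_asphericalValued_selection
    {X : Type*} [TopologicalSpace X] [T2Space X] [ParacompactSpace X] :
    IsCSpace X ↔
      ∀ (Y : Type) [TopologicalSpace Y] [T2Space Y] (Φ : X → Set Y),
        (∀ x, (Φ x).Nonempty) →
        LowerLocallyConstant Φ →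
        (∀ x, ∀ k : ℕ, EmbedIn k (Φ x) (Φ x)) →
        ∃ f : X → Y, Continuous f ∧ ∀ x, f x ∈ Φ x := by
  exact ⟨fun hX _ _ _ _ hne hΦ hA => hX.exists_selection hne hΦ hA,
    fun h => isCSpace_of_exists_selection (h DiscreteJoin)⟩
end
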